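/- arXiv:1711.08617 — 6 statements merged into one kernel-verified Lean document; each statement's English description precedes it below -/
import Mathlib

section
/- Let B be a standard Brownian motion. Let h, σ : [0,1) → ℝ be continuous with σ > 0 on [0,1), and assume conditions (A1) and (A2). Define φ(t) := exp(−∫₀ᵗ h(r) dr) and w(t) := ∫₀ᵗ σ(r)²/φ(r)² dr for t ∈ [0,1). Then for all x, y ∈ ℝ, almost surely lim_{t→1⁻} [ φ(t)·x + (1−φ(t))·y + φ(t)·B_{w(t)} ] = y. (This is Proposition 2 of the paper, the pinning property of the family of diffusions X^{xy}, formulated through the time-changed Brownian motion representation X^{xy}_t = φ(t)x + (1−φ(t))y + φ(t)B_{w(t)}, which has the same law as the solution of dX_t = h(t)(y−X_t)dt + σ(t)dB_t, X₀ = x.) -/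
open MeasureTheory ProbabilityTheory Filter Topology Set
open scoped NNReal

/-- A standard Brownian motion: a.s. continuous paths, starting at `0`,
Gaussian process (every finite linear combination of coordinates is Gaussian),
centered, with covariance `Cov(B_s, B_t) = min s t`. -/
def IsStandardBrownianMotion {Ω : Type*} [MeasurableSpace Ω] (P : Measure Ω)
    (B : ℝ → Ω → ℝ) : Prop :=
  (∀ᵐ ω ∂P, Continuous fun s => B s ω) ∧
  (∀ᵐ ω ∂P, B 0 ω = 0) ∧
  (∀ (n : ℕ) (c : Fin n → ℝ) (t : Fin n → ℝ), (∀ i, 0 ≤ t i) →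
    ∃ (μ : ℝ) (v : ℝ≥0), P.map (fun ω => ∑ i, c i * B (t i) ω) = gaussianReal μ v) ∧
  (∀ s : ℝ, 0 ≤ s → ∫ ω, B s ω ∂P = 0) ∧
  (∀ s t : ℝ, 0 ≤ s → 0 ≤ t → ∫ ω, B s ω * B t ω ∂P = min s t)

/-- A standard Brownian motion, restricted to nonnegative times, is a Brownian motion in the sense
of Mathlib. -/
theorem IsStandardBrownianMotion.isBrownianReal {Ω : Type*} [MeasurableSpace Ω] {P : Measure Ω}
    [IsProbabilityMeasure P] {B : ℝ → Ω → ℝ} (hB : IsStandardBrownianMotion P B) :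
    IsBrownianReal (fun (s : ℝ≥0) ω => B s ω) P := by
  obtain ⟨hcont, -, hgauss, hmean, hcov⟩ := hB
  have hmeas (t : ℝ≥0) : AEMeasurable (B t) P := by
    obtain ⟨μ, v, h⟩ := hgauss 1 (fun _ => 1) (fun _ => t) fun _ => t.2
    refine AEMeasurable.of_map_ne_zero (f := B t) ?_
    have h' : P.map (B t) = gaussianReal μ v := by simpa using h
    rw [h']
    exact IsProbabilityMeasure.ne_zero _
  have hproc : IsGaussianProcess (fun (s : ℝ≥0) ω => B s ω) P := by
    refine ⟨fun I => ⟨?_⟩⟩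
    have hI : AEMeasurable (fun ω => I.restrict fun s : ℝ≥0 => B s ω) P :=
      aemeasurable_pi_lambda _ fun i => hmeas i
    refine isGaussian_of_map_eq_gaussianReal fun L => ?_
    let e := I.equivFin
    obtain ⟨μ, v, h⟩ := hgauss I.card (fun i => L (Pi.single (e.symm i) 1))
      (fun i => ((e.symm i : ℝ≥0) : ℝ)) fun i => NNReal.coe_nonneg _
    refine ⟨μ, v, ?_⟩
    rw [AEMeasurable.map_map_of_aemeasurable (by fun_prop) hI, ← h]
    congr 1
    ext ω
    rw [Function.comp_apply, Equiv.sum_comp e.symm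
      (fun i : I => L (Pi.single i 1) * B (i : ℝ≥0) ω)]
    conv_lhs => rw [← Finset.univ_sum_single (I.restrict fun s : ℝ≥0 => B s ω)]
    rw [map_sum]
    refine Finset.sum_congr rfl fun i _ => ?_
    have : (Pi.single i (I.restrict (fun s : ℝ≥0 => B s ω) i) : I → ℝ)
        = (B (i : ℝ≥0) ω) • Pi.single i 1 := by
      rw [← Pi.single_smul]; simp
    rw [this, map_smul, smul_eq_mul, mul_comm]
  refine ⟨hproc.isPreBrownianReal_of_covariance (fun t => hmean t t.2) fun s t hst => ?_, ?_⟩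
  · rw [covariance_eq_sub (hproc.hasGaussianLaw_eval s).memLp_two
      (hproc.hasGaussianLaw_eval t).memLp_two, hmean s s.2, zero_mul, sub_zero]
    exact (hcov s t s.2 t.2).trans (min_eq_left (by exact_mod_cast hst))
  · filter_upwards [hcont] with ω hω
    exact hω.comp NNReal.continuous_coe

namespace ProbabilityTheory

variable {Ω : Type*} {mΩ : MeasurableSpace Ω} {P : Measure Ω} {B : ℝ≥0 → Ω → ℝ}

theorem IsPreBrownianReal.integral_sq (hB : IsPreBrownianReal B P) (t : ℝ≥0) :
    ∫ ω, B t ω ^ 2 ∂P = t := by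
  have := hB.isGaussianProcess.isProbabilityMeasure
  have h := covariance_eq_sub (hB.isGaussianProcess.hasGaussianLaw_eval t).memLp_two
    (hB.isGaussianProcess.hasGaussianLaw_eval t).memLp_two
  rw [hB.covariance_eval, hB.integral_eval, min_self, mul_zero, sub_zero] at h
  simp [h, pow_two]

theorem IsPreBrownianReal.martingale (hB : IsPreBrownianReal B P)
    (hm : ∀ t, StronglyMeasurable (B t)) :
    Martingale B (Filtration.natural B hm) P := by
  have := hB.isGaussianProcess.isProbabilityMeasure
  have hadp := Filtration.stronglyAdapted_natural hm
  refine ⟨hadp, fun s t hst => ?_⟩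
  have hind := hB.indepFun_shift s
  rw [IndepFun_iff_Indep, ← Filtration.natural_eq_comap B hm s] at hind
  have hincr : P[B t - B s | Filtration.natural B hm s] =ᵐ[P] 0 := by
    refine (condExp_indep_eq ?_ ((Filtration.natural B hm).le s) ?_ hind).trans ?_
    · exact Measurable.comap_le
        (measurable_pi_lambda _ fun r => (hm _).measurable.sub (hm _).measurable)
    · have h : B t - B s = (fun x : ℝ≥0 → ℝ => x (t - s)) ∘ fun ω r => B (s + r) ω - B s ω := by
        ext ω
        simp [add_tsub_cancel_of_le hst]
      rw [h]
      have hev : Measurable fun x : ℝ≥0 → ℝ => x (t - s) := measurable_pi_apply _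
      exact (hev.comp (comap_measurable _)).stronglyMeasurable
    · rw [integral_sub' (hB.integrable_eval t) (hB.integrable_eval s), hB.integral_eval,
        hB.integral_eval, sub_zero]
      rfl
  filter_upwards [hincr, condExp_sub (hB.integrable_eval t) (hB.integrable_eval s)
    (Filtration.natural B hm s)] with ω h₁ h₂
  rw [h₁, Pi.sub_apply, condExp_of_stronglyMeasurable ((Filtration.natural B hm).le s) (hadp s)
    (hB.integrable_eval s)] at h₂
  simp only [Pi.zero_apply] at h₂
  linarith

theorem IsPreBrownianReal.submartingale_sq (hB : IsPreBrownianReal B P)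
    (hm : ∀ t, StronglyMeasurable (B t)) :
    Submartingale (fun t ω => B t ω ^ 2) (Filtration.natural B hm) P := by
  have := hB.isGaussianProcess.isProbabilityMeasure
  have hint (t : ℝ≥0) : Integrable (fun ω => B t ω ^ 2) P :=
    (hB.isGaussianProcess.hasGaussianLaw_eval t).memLp_two.integrable_sq
  refine ⟨fun t => (Filtration.stronglyAdapted_natural hm t).pow 2, fun s t hst => ?_, hint⟩
  filter_upwards [(hB.martingale hm).condExp_ae_eq hst,
    (even_two.convexOn_pow (𝕜 := ℝ)).map_condExp_le_univ ((Filtration.natural B hm).le s)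
      (continuous_pow 2).lowerSemicontinuous (hB.integrable_eval t) (hint t)] with ω h₁ h₂
  rw [← h₁]
  exact h₂

/-- **Kolmogorov's maximal inequality** for a pre-Brownian motion along finitely many times. -/
theorem IsPreBrownianReal.measure_exists_lt_abs_le (hB : IsPreBrownianReal B P) {s : ℕ → ℝ≥0}
    (hs : Monotone s) (n : ℕ) {l : ℝ} (hl : 0 < l) :
    P {ω | ∃ k ≤ n, l < |B (s k) ω|} ≤ ENNReal.ofReal (s n / l ^ 2) := by
  have := hB.isGaussianProcess.isProbabilityMeasure
  wlog hm : ∀ t, StronglyMeasurable (B t) generalizing B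
  · let C t := (hB.aemeasurable t).mk
    have hC t : B t =ᵐ[P] C t := (hB.aemeasurable t).ae_eq_mk
    refine le_trans (measure_mono_ae ?_) (this (hB.congr hC)
      fun t => (hB.aemeasurable t).measurable_mk.stronglyMeasurable)
    filter_upwards [ae_all_iff.2 fun k : ℕ => hC (s k)] with ω hω h
    obtain ⟨k, hk, h⟩ := h
    exact ⟨k, hk, hω k ▸ h⟩
  let 𝒢 : Filtration ℕ mΩ :=
    { seq k := Filtration.natural B hm (s k)
      mono' _ _ hij := (Filtration.natural B hm).mono (hs hij)
      le' _ := (Filtration.natural B hm).le _ }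
  have hsub := hB.submartingale_sq hm
  have hsub' : Submartingale (fun k ω => B (s k) ω ^ 2) 𝒢 P :=
    ⟨fun k => hsub.1 (s k), fun i j hij => hsub.2.1 _ _ (hs hij), fun k => hsub.2.2 (s k)⟩
  have hmax := maximal_ineq hsub' (fun k ω => sq_nonneg _) (ε := ⟨l ^ 2, sq_nonneg l⟩) n
  set S := {ω | ((⟨l ^ 2, sq_nonneg l⟩ : ℝ≥0) : ℝ) ≤
    (Finset.range (n + 1)).sup' Finset.nonempty_range_add_one fun k => B (s k) ω ^ 2}
  have hle : ∫ ω in S, B (s n) ω ^ 2 ∂P ≤ s n := by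
    rw [← hB.integral_sq]
    exact setIntegral_le_integral (hsub.2.2 _) (ae_of_all _ fun ω => sq_nonneg _)
  have hsubset : {ω | ∃ k ≤ n, l < |B (s k) ω|} ⊆ S := by
    rintro ω ⟨k, hk, h⟩
    refine le_trans ?_ (Finset.le_sup' (fun k => B (s k) ω ^ 2) (by simp; omega : k ∈ _))
    simpa using pow_le_pow_left₀ hl.le h.le 2
  refine (measure_mono hsubset).trans ?_
  rw [ENNReal.ofReal_div_of_pos (by positivity), ENNReal.le_div_iff_mul_le
    (.inl (by simpa using hl.ne')) (.inl ENNReal.ofReal_ne_top), mul_comm]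
  refine le_trans (le_of_eq ?_) (hmax.trans (ENNReal.ofReal_le_ofReal hle))
  congr 1
  exact ENNReal.ofReal_eq_coe_nnreal (sq_nonneg l)

/-- **Kolmogorov's maximal inequality** for Brownian motion. -/
theorem IsBrownianReal.measure_exists_lt_abs_le (hB : IsBrownianReal B P) (T : ℝ≥0) {l : ℝ}
    (hl : 0 < l) :
    P {ω | ∃ s ≤ T, l < |B s ω|} ≤ ENNReal.ofReal (T / l ^ 2) := by
  let s (m k : ℕ) : ℝ≥0 := k / m * T
  let E (m : ℕ) : Set Ω := {ω | ∃ k ≤ m, l < |B (s m k) ω|}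
  have hE (m : ℕ) (hm : 0 < m) : P (E m) ≤ ENNReal.ofReal (T / l ^ 2) := by
    have hs : Monotone (s m) := fun i j hij => by
      have : (i : ℝ≥0) ≤ j := by exact_mod_cast hij
      simp only [s]
      gcongr
    have hsm : s m m = T := by
      simp [s, div_self (Nat.cast_ne_zero.2 hm.ne' : (m : ℝ≥0) ≠ 0)]
    simpa only [hsm] using hB.toIsPreBrownianReal.measure_exists_lt_abs_le hs m hl
  have hsub : {ω | ∃ s ≤ T, l < |B s ω|} ≤ᵐ[P] ⋃ m, ⋂ k ≥ m, E k := by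
    filter_upwards [hB.cont] with ω hω h
    obtain ⟨u, hu, h⟩ := h
    let a : ℝ≥0 := u / T
    have ha : a ≤ 1 := div_le_one_of_le₀ hu zero_le
    have hau : a * T = u := by
      obtain rfl | hT := eq_or_ne T 0
      · simpa using hu.antisymm zero_le |>.symm
      · exact div_mul_cancel₀ _ hT
    have hlim : Tendsto (fun m : ℕ => s m ⌊(a : ℝ) * m⌋₊) atTop (𝓝 u) := by
      rw [← NNReal.tendsto_coe, ← hau, NNReal.coe_mul]
      simp only [s, NNReal.coe_mul, NNReal.coe_div, NNReal.coe_natCast]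
      exact ((tendsto_nat_floor_mul_div_atTop a.2).comp tendsto_natCast_atTop_atTop).mul_const _
    have hev : ∀ᶠ m : ℕ in atTop, l < |B (s m ⌊(a : ℝ) * m⌋₊) ω| :=
      ((hω.abs.tendsto u).comp hlim).eventually (lt_mem_nhds h)
    obtain ⟨m, hm⟩ := eventually_atTop.1 hev
    refine mem_iUnion.2 ⟨m, mem_iInter₂.2 fun k hk => ⟨_, ?_, hm k hk⟩⟩
    refine Nat.floor_le_of_le (mul_le_of_le_one_left (Nat.cast_nonneg k) ?_)
    exact_mod_cast ha
  refine (measure_mono_ae hsub).trans ?_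
  have hmono : Monotone fun m => ⋂ k ≥ m, E k := fun i j hij =>
    biInter_mono (fun k (hk : k ≥ j) => hij.trans hk) fun _ _ => Subset.rfl
  rw [hmono.measure_iUnion]
  exact iSup_le fun m => (measure_mono (biInter_subset_of_mem (Nat.le_succ m))).trans
    (hE (m + 1) m.succ_pos)

/-- A Borel-Cantelli type control of the growth of Brownian motion. -/
theorem IsBrownianReal.ae_forall_eventually_abs_le (hB : IsBrownianReal B P) {T : ℕ → ℝ≥0}
    {l : ℕ → ℝ} (hl : ∀ n, 0 < l n) (hsum : Summable fun n => (T n : ℝ) / l n ^ 2) :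
    ∀ᵐ ω ∂P, ∀ ε > 0, ∀ᶠ n in atTop, ∀ s ≤ T n, |B s ω| ≤ ε * l n := by
  have key (j : ℕ) : ∀ᵐ ω ∂P, ∀ᶠ n in atTop, ∀ s ≤ T n, |B s ω| ≤ 1 / (j + 1 : ℝ) * l n := by
    have hj : (0 : ℝ) < 1 / (j + 1) := by positivity
    have hne : ∑' n, P {ω | ∃ s ≤ T n, 1 / (j + 1 : ℝ) * l n < |B s ω|} ≠ ⊤ := by
      refine ne_top_of_le_ne_top ?_ (ENNReal.tsum_le_tsum fun n =>
        hB.measure_exists_lt_abs_le (T n) (mul_pos hj (hl n)))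
      refine Summable.tsum_ofReal_ne_top ?_
      convert! hsum.mul_left ((1 / (j + 1 : ℝ)) ^ 2)⁻¹ using 2 with n
      rw [mul_pow, div_eq_mul_inv, mul_inv, div_eq_mul_inv]
      ring
    filter_upwards [ae_eventually_notMem hne] with ω hω
    filter_upwards [hω] with n hn s hs
    by_contra! h
    exact hn ⟨s, hs, h⟩
  filter_upwards [ae_all_iff.2 key] with ω hω ε hε
  obtain ⟨j, hj⟩ := exists_nat_one_div_lt hε
  filter_upwards [hω j] with n hn s hs
  exact (hn s hs).trans (mul_le_mul_of_nonneg_right hj.le (hl n).le)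

end ProbabilityTheory

theorem ContinuousOn.intervalIntegrable_of_mem_Ico {f : ℝ → ℝ} (hf : ContinuousOn f (Ico 0 1))
    {s t : ℝ} (hs : s ∈ Ico (0 : ℝ) 1) (ht : t ∈ Ico (0 : ℝ) 1) :
    IntervalIntegrable f volume s t :=
  (hf.mono fun _ hu => ⟨(le_min hs.1 ht.1).trans hu.1,
    hu.2.trans_lt (max_lt hs.2 ht.2)⟩).intervalIntegrable

theorem ContinuousOn.continuousOn_primitive_Ico {f : ℝ → ℝ} (hf : ContinuousOn f (Ico 0 1)) :
    ContinuousOn (fun t => ∫ r in (0 : ℝ)..t, f r) (Ico 0 1) := by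
  intro t ht
  obtain ⟨u, htu, hu⟩ := exists_between ht.2
  have hint : IntegrableOn f (uIcc 0 u) :=
    ((hf.mono fun x hx => by
      rw [uIcc_of_le (ht.1.trans htu.le)] at hx
      exact ⟨hx.1, hx.2.trans_lt hu⟩ :
      ContinuousOn f (uIcc 0 u)).integrableOn_compact isCompact_uIcc)
  have h := intervalIntegral.continuousOn_primitive_interval hint
  rw [uIcc_of_le (ht.1.trans htu.le)] at h
  refine (h t ⟨ht.1, htu.le⟩).mono_of_mem_nhdsWithin ?_
  filter_upwards [self_mem_nhdsWithin, mem_nhdsWithin_of_mem_nhds (Iio_mem_nhds htu)] with x hx hx'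
  exact ⟨hx.1, le_of_lt hx'⟩

/-- A sequence `a` whose increments satisfy `a (n + 1) - a n ≤ q⁻¹ ^ (n + 1) * (b (n + 1) - b n)`
with `b` bounded is summable against `q ^ n`. -/
theorem summable_mul_pow_of_sub_le {a b : ℕ → ℝ} {q L : ℝ} (hq : 0 < q) (hq1 : q < 1)
    (ha : ∀ n, 0 ≤ a n) (hb : ∀ n, b n ≤ L)
    (hab : ∀ n, (a (n + 1) - a n) * q ^ (n + 1) ≤ b (n + 1) - b n) :
    Summable fun n => a n * q ^ n := by
  have hsum (N : ℕ) : (1 - q) * ∑ n ∈ Finset.range N, a n * q ^ n + a N * q ^ N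
      ≤ a 0 + b N - b 0 := by
    induction N with
    | zero => simp
    | succ N ih =>
      rw [Finset.sum_range_succ]
      have := hab N
      rw [pow_succ] at this ⊢
      linarith
  refine summable_of_sum_range_le (c := (a 0 + L - b 0) / (1 - q))
    (fun n => mul_nonneg (ha n) (pow_nonneg hq.le n)) fun N => ?_
  rw [le_div_iff₀ (sub_pos.2 hq1), mul_comm]
  linarith [hsum N, hb N, mul_nonneg (ha N) (pow_nonneg hq.le N)]

/-- If `H` is continuous nondecreasing on `[0, 1)` and tends to `+∞` at `1`, it passes through every
natural number, at times that can be chosen in increasing order. -/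
theorem exists_seq_mem_Ico_eq_natCast {H : ℝ → ℝ} (hH : ContinuousOn H (Ico 0 1))
    (hmono : MonotoneOn H (Ico 0 1)) (h0 : H 0 = 0) (hlim : Tendsto H (𝓝[<] 1) atTop) :
    ∃ τ : ℕ → ℝ, (∀ n, τ n ∈ Ico (0 : ℝ) 1) ∧ (∀ n, H (τ n) = n) ∧ Monotone τ := by
  have hex (n : ℕ) : ∃ t ∈ Ico (0 : ℝ) 1, H t = n := by
    obtain ⟨u, hu, hu'⟩ := ((hlim.eventually_ge_atTop (n : ℝ)).and
      (Ico_mem_nhdsLT (zero_lt_one' ℝ))).exists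
    have hsub : Icc 0 u ⊆ Ico (0 : ℝ) 1 := Icc_subset_Ico_right hu'.2
    obtain ⟨t, ht, h⟩ := intermediate_value_Icc hu'.1 (hH.mono hsub)
      (⟨h0.trans_le n.cast_nonneg, hu⟩ : (n : ℝ) ∈ Icc (H 0) (H u))
    exact ⟨t, hsub ht, h⟩
  choose τ hτ hHτ using hex
  refine ⟨τ, hτ, hHτ, monotone_nat_of_le_succ fun n => ?_⟩
  by_contra! hlt
  have := hmono (hτ (n + 1)) (hτ n) hlt.le
  rw [hHτ, hHτ] at this
  exact absurd (Nat.cast_le.1 this) (by omega)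

/-- Proposition 2 (pinning property): under (A1)-(A2), for all `x, y`, almost surely
`φ(t)·x + (1−φ(t))·y + φ(t)·B_{w(t)} → y` as `t → 1⁻`. -/
theorem pinned_diffusion
    {Ω : Type*} [MeasurableSpace Ω] (P : Measure Ω) [IsProbabilityMeasure P]
    (B : ℝ → Ω → ℝ) (hB : IsStandardBrownianMotion P B)
    (h σ : ℝ → ℝ)
    (hh : ContinuousOn h (Set.Ico 0 1)) (hσ : ContinuousOn σ (Set.Ico 0 1))
    (hσpos : ∀ t ∈ Set.Ico (0:ℝ) 1, 0 < σ t)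
    -- (A1): `h` is bounded from below and `∫₀ᵗ h → +∞` as `t → 1⁻`.
    (hA1bdd : ∃ c : ℝ, ∀ t ∈ Set.Ico (0:ℝ) 1, c ≤ h t)
    (hA1div : Tendsto (fun t => ∫ r in (0:ℝ)..t, h r) (𝓝[<] 1) atTop)
    -- (A2): `lim_{t→1⁻} ∫₀ᵗ σ² < ∞`.
    (hA2 : ∃ L : ℝ, Tendsto (fun t => ∫ r in (0:ℝ)..t, (σ r) ^ 2) (𝓝[<] 1) (𝓝 L))
    (φ w : ℝ → ℝ)
    (hφ : ∀ t ∈ Set.Ico (0:ℝ) 1, φ t = Real.exp (-∫ r in (0:ℝ)..t, h r))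
    (hw : ∀ t ∈ Set.Ico (0:ℝ) 1, w t = ∫ r in (0:ℝ)..t, (σ r) ^ 2 / (φ r) ^ 2) :
    ∀ x y : ℝ, ∀ᵐ ω ∂P,
      Tendsto (fun t => φ t * x + (1 - φ t) * y + φ t * B (w t) ω) (𝓝[<] 1) (𝓝 y) := by
  intro x y
  obtain ⟨c, hc⟩ := hA1bdd
  obtain ⟨L, hL⟩ := hA2
  have hzero : (0 : ℝ) ∈ Ico (0 : ℝ) 1 := by simp
  have hIco : ∀ᶠ t in 𝓝[<] (1 : ℝ), t ∈ Ico (0 : ℝ) 1 := Ico_mem_nhdsLT zero_lt_one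
  set g : ℝ → ℝ := fun t => ∫ r in (0 : ℝ)..t, h r with hg
  have hgcont : ContinuousOn g (Ico 0 1) := hh.continuousOn_primitive_Ico
  -- `H` is a nondecreasing function at bounded distance from `g = -log φ`.
  let H : ℝ → ℝ := fun t => g t + |c| * t
  have hH0 : H 0 = 0 := by simp [H, hg]
  have hHcont : ContinuousOn H (Ico 0 1) := hgcont.add (by fun_prop)
  have hHmono : MonotoneOn H (Ico 0 1) := by
    intro s hs t ht hst
    have hsplit : g t - g s = ∫ r in s..t, h r :=
      intervalIntegral.integral_interval_sub_left (hh.intervalIntegrable_of_mem_Ico hzero ht)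
        (hh.intervalIntegrable_of_mem_Ico hzero hs)
    have hge : ∫ _ in s..t, -|c| ≤ ∫ r in s..t, h r :=
      intervalIntegral.integral_mono_on hst intervalIntegrable_const
        (hh.intervalIntegrable_of_mem_Ico hs ht) fun r hr =>
          (neg_abs_le c).trans (hc r ⟨hs.1.trans hr.1, hr.2.trans_lt ht.2⟩)
    rw [intervalIntegral.integral_const, smul_eq_mul, ← hsplit] at hge
    simp only [H]
    linarith
  have hHlim : Tendsto H (𝓝[<] 1) atTop := by
    refine tendsto_atTop_mono' _ ?_ hA1div
    filter_upwards [hIco] with t ht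
    exact le_add_of_nonneg_right (mul_nonneg (abs_nonneg c) ht.1)
  have hgH (t : ℝ) (ht : t ∈ Ico (0 : ℝ) 1) : g t ≤ H t ∧ H t ≤ g t + |c| :=
    ⟨le_add_of_nonneg_right (mul_nonneg (abs_nonneg c) ht.1),
      add_le_add_right (mul_le_of_le_one_right (abs_nonneg c) ht.2.le) _⟩
  obtain ⟨τ, hτ, hHτ, hτmono⟩ := exists_seq_mem_Ico_eq_natCast hHcont hHmono hH0 hHlim
  have hφcont : ContinuousOn φ (Ico 0 1) := (hgcont.neg.rexp).congr hφ
  have hφpos (t : ℝ) (ht : t ∈ Ico (0 : ℝ) 1) : 0 < φ t := hφ t ht ▸ Real.exp_pos _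
  have hσ2 : ContinuousOn (fun r => σ r ^ 2) (Ico 0 1) := hσ.pow 2
  have hf : ContinuousOn (fun r => σ r ^ 2 / φ r ^ 2) (Ico 0 1) :=
    hσ2.div (hφcont.pow 2) fun r hr => pow_ne_zero 2 (hφpos r hr).ne'
  have hwsub {s t : ℝ} (hs : s ∈ Ico (0 : ℝ) 1) (ht : t ∈ Ico (0 : ℝ) 1) :
      w t - w s = ∫ r in s..t, σ r ^ 2 / φ r ^ 2 := by
    rw [hw t ht, hw s hs]
    exact intervalIntegral.integral_interval_sub_left (hf.intervalIntegrable_of_mem_Ico hzero ht)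
      (hf.intervalIntegrable_of_mem_Ico hzero hs)
  have hwmono : MonotoneOn w (Ico 0 1) := fun s hs t ht hst => by
    rw [← sub_nonneg, hwsub hs ht]
    exact intervalIntegral.integral_nonneg hst fun r _ => by positivity
  have hw0 : w 0 = 0 := by simp [hw 0 hzero]
  have hwnonneg (t : ℝ) (ht : t ∈ Ico (0 : ℝ) 1) : 0 ≤ w t := hw0 ▸ hwmono hzero ht ht.1
  set v : ℝ → ℝ := fun t => ∫ r in (0 : ℝ)..t, σ r ^ 2
  have hvsub {s t : ℝ} (hs : s ∈ Ico (0 : ℝ) 1) (ht : t ∈ Ico (0 : ℝ) 1) :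
      v t - v s = ∫ r in s..t, σ r ^ 2 :=
    intervalIntegral.integral_interval_sub_left (hσ2.intervalIntegrable_of_mem_Ico hzero ht)
      (hσ2.intervalIntegrable_of_mem_Ico hzero hs)
  have hvle (t : ℝ) (ht : t ∈ Ico (0 : ℝ) 1) : v t ≤ L := by
    refine ge_of_tendsto hL ?_
    filter_upwards [Ico_mem_nhdsLT ht.2] with s hs
    have hs' : s ∈ Ico (0 : ℝ) 1 := ⟨ht.1.trans hs.1, hs.2⟩
    rw [← sub_nonneg]
    exact (hvsub ht hs').symm ▸ intervalIntegral.integral_nonneg hs.1 fun r _ => sq_nonneg _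
  have hsum : Summable fun n => w (τ n) * Real.exp (-2) ^ n := by
    refine summable_mul_pow_of_sub_le (b := fun n => v (τ n)) (Real.exp_pos _) (by simp)
      (fun n => hwnonneg _ (hτ n)) (fun n => hvle _ (hτ n)) fun n => ?_
    rw [hwsub (hτ n) (hτ (n + 1)), hvsub (hτ n) (hτ (n + 1)),
      ← intervalIntegral.integral_mul_const]
    refine intervalIntegral.integral_mono_on (hτmono n.le_succ)
      ((hf.intervalIntegrable_of_mem_Ico (hτ n) (hτ (n + 1))).mul_const _)
      (hσ2.intervalIntegrable_of_mem_Ico (hτ n) (hτ (n + 1))) fun r hr => ?_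
    have hr' : r ∈ Ico (0 : ℝ) 1 := ⟨(hτ n).1.trans hr.1, hr.2.trans_lt (hτ (n + 1)).2⟩
    have hgr : g r ≤ (n + 1 : ℕ) :=
      (hgH r hr').1.trans ((hHmono hr' (hτ (n + 1)) hr.2).trans_eq (hHτ _))
    have hle : Real.exp (-2) ^ (n + 1) ≤ φ r ^ 2 := by
      rw [hφ r hr', ← Real.exp_nat_mul, ← Real.exp_nat_mul, Real.exp_le_exp]
      push_cast at hgr ⊢
      linarith
    rw [div_mul_eq_mul_div, div_le_iff₀ (pow_pos (hφpos r hr') 2)]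
    exact mul_le_mul_of_nonneg_left hle (sq_nonneg _)
  have hφzero : Tendsto φ (𝓝[<] 1) (𝓝 0) :=
    (Real.tendsto_exp_neg_atTop_nhds_zero.comp hA1div).congr' (by
      filter_upwards [hIco] with t ht using (hφ t ht).symm)
  have hgrowth := hB.isBrownianReal.ae_forall_eventually_abs_le
    (T := fun n => (w (τ (n + 1))).toNNReal) (l := fun n : ℕ => Real.exp n)
    (fun n => Real.exp_pos _) (by
      refine (((summable_nat_add_iff 1).2 hsum).mul_left (Real.exp 2)).congr fun n => ?_
      rw [Real.coe_toNNReal _ (hwnonneg _ (hτ _)), div_eq_mul_inv, ← Real.exp_nat_mul,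
        ← Real.exp_nat_mul, ← Real.exp_neg, mul_left_comm, ← Real.exp_add]
      congr 2
      push_cast
      ring)
  filter_upwards [hgrowth] with ω hω
  have hBzero : Tendsto (fun t => φ t * B (w t) ω) (𝓝[<] 1) (𝓝 0) := by
    rw [Metric.tendsto_nhds]
    intro ε hε
    have hfloor : Tendsto (fun t => ⌊H t⌋₊) (𝓝[<] 1) atTop := tendsto_nat_floor_atTop.comp hHlim
    filter_upwards [hIco, hfloor.eventually (hω (ε / 2 * Real.exp (-|c|)) (by positivity))]
      with t ht hbound
    set n := ⌊H t⌋₊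
    have hHt : 0 ≤ H t := hH0 ▸ hHmono hzero ht ht.1
    have htτ : t ≤ τ (n + 1) := by
      by_contra! hlt
      have h₁ := hHmono (hτ (n + 1)) ht hlt.le
      rw [hHτ] at h₁
      have h₂ := Nat.lt_floor_add_one (H t)
      push_cast at h₁
      linarith
    have hBt := hbound (w t).toNNReal (Real.toNNReal_le_toNNReal (hwmono ht (hτ (n + 1)) htτ))
    rw [Real.coe_toNNReal _ (hwnonneg t ht)] at hBt
    have hφt : φ t ≤ Real.exp (|c| - n) := by
      rw [hφ t ht, Real.exp_le_exp]
      linarith [(hgH t ht).2, Nat.floor_le hHt]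
    rw [Real.dist_0_eq_abs, abs_mul, abs_of_pos (hφpos t ht)]
    calc φ t * |B (w t) ω|
        ≤ Real.exp (|c| - n) * (ε / 2 * Real.exp (-|c|) * Real.exp n) := by gcongr
      _ = ε / 2 * Real.exp ((|c| - n) + -|c| + n) := by rw [Real.exp_add, Real.exp_add]; ring
      _ = ε / 2 := by rw [show |c| - n + -|c| + n = 0 by ring, Real.exp_zero, mul_one]
      _ < ε := half_lt_self hε
  have hlim := ((hφzero.mul_const x).add ((hφzero.const_sub 1).mul_const y)).add hBzero
  simpa using hlim
end

section
/- Let σ : [0,1) → ℝ be continuous and positive, let u₁ > 0, and let φ : [0,1) → (0,∞) be a differentiable function with φ(0) = 1 and lim_{t→1⁻} φ(t) = 0, such that ∫₀ˢ σ(r)²/φ(r)² dr = u₁·(1−φ(s))/φ(s) for all s ∈ (0,1). Then Σ := lim_{t→1⁻} ∫₀ᵗ σ(r)² dr is finite and equals u₁, φ(t) = 1 − (1/Σ)·∫₀ᵗ σ(r)² dr for all t ∈ [0,1), and −φ'(t)/φ(t) = σ(t)²/(Σ − ∫₀ᵗ σ(r)² dr) for all t ∈ [0,1). (This is the key step in the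 'only if' direction of Theorem 3: the covariance matching forces the relation h(t) = σ²(t)/(Σ − ∫₀ᵗ σ²(r) dr).) -/
open Filter Topology Set

/-- First fundamental theorem of calculus on a half-open interval. -/
theorem hasDerivWithinAt_integral_of_continuousOn_Ico {f : ℝ → ℝ} {a b : ℝ}
    (hf : ContinuousOn f (Ico a b)) {t : ℝ} (ht : t ∈ Ico a b) :
    HasDerivWithinAt (fun x => ∫ r in a..x, f r) (f t) (Ico a b) t := by
  have hg : ContinuousOn (fun x => f (max a x)) (Iio b) :=
    hf.comp (by fun_prop) fun x hx => ⟨le_max_left _ _, max_lt (ht.1.trans_lt ht.2) hx⟩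
  have hd : HasDerivAt (fun x => ∫ r in a..x, f (max a r)) (f (max a t)) t := by
    refine intervalIntegral.integral_hasDerivAt_right ?_
      (hg.stronglyMeasurableAtFilter isOpen_Iio t ht.2) (hg.continuousAt (Iio_mem_nhds ht.2))
    refine (hg.mono fun x hx => ?_).intervalIntegrable
    rw [uIcc_of_le ht.1] at hx
    exact hx.2.trans_lt ht.2
  have heq : ∀ x ∈ Ico a b, (∫ r in a..x, f r) = ∫ r in a..x, f (max a r) := by
    intro x hx
    refine intervalIntegral.integral_congr fun r hr => ?_
    rw [uIcc_of_le hx.1] at hr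
    simp only [max_eq_right hr.1]
  rw [max_eq_right ht.1] at hd
  exact hd.hasDerivWithinAt.congr heq (heq t ht)

/-- Key step of the 'only if' direction of Theorem 3: if `φ` is positive and differentiable on
`[0,1)` with `φ(0) = 1`, `φ(t) → 0` as `t → 1⁻`, and the covariance-matching relation
`∫₀ˢ σ²/φ² = u₁(1−φ(s))/φ(s)` holds on `(0,1)`, then `Σ := lim_{t→1⁻} ∫₀ᵗ σ²` is finite and
equals `u₁`, `φ(t) = 1 − (1/Σ)∫₀ᵗ σ²`, and `−φ'/φ = σ²/(Σ − ∫₀ᵗ σ²)` on `[0,1)`. -/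
theorem covariance_matching_forces_h
    (σ : ℝ → ℝ) (hσ : ContinuousOn σ (Set.Ico 0 1))
    (hσpos : ∀ t ∈ Set.Ico (0:ℝ) 1, 0 < σ t)
    (u₁ : ℝ) (hu₁ : 0 < u₁)
    (φ : ℝ → ℝ)
    (hφpos : ∀ t ∈ Set.Ico (0:ℝ) 1, 0 < φ t)
    (hφdiff : ∀ t ∈ Set.Ico (0:ℝ) 1, DifferentiableWithinAt ℝ φ (Set.Ico 0 1) t)
    (hφ0 : φ 0 = 1)
    (hφ1 : Tendsto φ (𝓝[<] 1) (𝓝 0))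
    (hmatch : ∀ s ∈ Set.Ioo (0:ℝ) 1,
      (∫ r in (0:ℝ)..s, (σ r) ^ 2 / (φ r) ^ 2) = u₁ * (1 - φ s) / φ s) :
    Tendsto (fun t => ∫ r in (0:ℝ)..t, (σ r) ^ 2) (𝓝[<] 1) (𝓝 u₁) ∧
    (∀ t ∈ Set.Ico (0:ℝ) 1, φ t = 1 - (1 / u₁) * ∫ r in (0:ℝ)..t, (σ r) ^ 2) ∧
    (∀ t ∈ Set.Ico (0:ℝ) 1,
      -(derivWithin φ (Set.Ico 0 1) t) / φ t
        = (σ t) ^ 2 / (u₁ - ∫ r in (0:ℝ)..t, (σ r) ^ 2)) := by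
  have hderiv : ∀ t ∈ Ico (0:ℝ) 1, derivWithin φ (Ico 0 1) t = -(σ t ^ 2 / u₁) := by
    intro t ht
    have hu : UniqueDiffWithinAt ℝ (Ico (0:ℝ) 1) t := uniqueDiffOn_Ico 0 1 t ht
    have hφt := (hφpos t ht).ne'
    have hφcont : ContinuousOn φ (Ico 0 1) := fun x hx => (hφdiff x hx).continuousWithinAt
    have hI := hasDerivWithinAt_integral_of_continuousOn_Ico (f := fun r => σ r ^ 2 / φ r ^ 2)
      ((hσ.pow 2).div (hφcont.pow 2) fun x hx => pow_ne_zero 2 (hφpos x hx).ne') ht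
    have hR := (((hφdiff t ht).hasDerivWithinAt.const_sub 1).const_mul u₁).fun_div
      (hφdiff t ht).hasDerivWithinAt hφt
    have heq : ∀ s ∈ Ico (0:ℝ) 1,
        u₁ * (1 - φ s) / φ s = ∫ r in (0:ℝ)..s, σ r ^ 2 / φ r ^ 2 := by
      intro s hs
      rcases hs.1.eq_or_lt with rfl | h
      · simp [hφ0]
      · exact (hmatch s ⟨h, hs.2⟩).symm
    have h := hu.eq_deriv _ (hI.congr heq (heq t ht)) hR
    field_simp at h ⊢
    linarith
  have hφeq : ∀ t ∈ Ico (0:ℝ) 1, u₁ * φ t + ∫ r in (0:ℝ)..t, σ r ^ 2 = u₁ := by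
    intro t ht
    have hd : ∀ x ∈ Ico (0:ℝ) 1,
        HasDerivWithinAt (fun t => u₁ * φ t + ∫ r in (0:ℝ)..t, σ r ^ 2) 0 (Ico 0 1) x := by
      intro x hx
      have h := ((hφdiff x hx).hasDerivWithinAt.const_mul u₁).fun_add
        (hasDerivWithinAt_integral_of_continuousOn_Ico (hσ.pow 2) hx)
      refine h.congr_deriv ?_
      simp only [hderiv x hx, Pi.pow_apply]
      field_simp
      ring
    have h := (convex_Ico (0:ℝ) 1).norm_image_sub_le_of_norm_hasDerivWithin_le (C := 0) hd
      (by simp) (left_mem_Ico.2 one_pos) ht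
    simpa [hφ0, sub_eq_zero] using h
  refine ⟨?_, fun t ht => ?_, fun t ht => ?_⟩
  · have h : Tendsto (fun t => u₁ - u₁ * φ t) (𝓝[<] 1) (𝓝 u₁) := by
      simpa using (hφ1.const_mul u₁).const_sub u₁
    refine h.congr' ?_
    filter_upwards [Ioo_mem_nhdsLT one_pos] with t ht
    linarith [hφeq t (Ioo_subset_Ico_self ht)]
  · have h := hφeq t ht
    field_simp
    linarith
  · have hφt := (hφpos t ht).ne'
    rw [hderiv t ht, show u₁ - ∫ r in (0:ℝ)..t, σ r ^ 2 = u₁ * φ t by linarith [hφeq t ht]]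
    field_simp
end

section
/- Let Z = (Z_t)_{t∈[a,b]} be a real-valued stochastic process with almost surely continuous paths which is a Gaussian process, which is non-degenerate in the sense that Var(Z_t) > 0 for all t ∈ [a,b] and |Corr(Z_s, Z_t)| < 1 for all s ≠ t, and which has the Markov property: for every t ∈ [a,b], the σ-algebras σ(Z_s : s ≤ t) and σ(Z_u : u ≥ t) are conditionally independent given σ(Z_t). Then there exist continuous functions m, u, v : [a,b] → ℝ with u > 0, v > 0 and v non-decreasing, and a standard Brownian motion B̂, such that Z has the same finite-dimensional distributions as the process ( m(t) + u(t)·B̂_{v(t)} )_{t∈[a,b]}. (Lemma 4 of the paper: representation of continuous non-degenerate Gaussian Markov processes as space-time scaled Brownian motions.) -/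
open MeasureTheory ProbabilityTheory Filter Topology Set
open scoped NNReal

/-- Covariance of two real random variables. -/
noncomputable def cov {Ω : Type*} [MeasurableSpace Ω] (P : Measure Ω) (X Y : Ω → ℝ) : ℝ :=
  ∫ ω, (X ω - ∫ ω', X ω' ∂P) * (Y ω - ∫ ω', Y ω' ∂P) ∂P

namespace GaussianMarkov

section GaussianProcesses

variable {Ω Ω' T : Type*} [MeasurableSpace Ω] [MeasurableSpace Ω'] {P : Measure Ω}
  {P' : Measure Ω'}

lemma apply_eq_sum_single_mul {ι : Type*} [Fintype ι] [DecidableEq ι] (L : (ι → ℝ) →L[ℝ] ℝ)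
    (x : ι → ℝ) : L x = ∑ i, L (Pi.single i 1) * x i := by
  conv_lhs => rw [← Finset.univ_sum_single x, map_sum]
  refine Finset.sum_congr rfl fun i _ => ?_
  rw [← mul_one (x i), ← smul_eq_mul, Pi.single_smul', map_smul, smul_eq_mul, smul_eq_mul, mul_one,
    mul_comm]

/-- A process all of whose finite linear combinations are Gaussian is a Gaussian process. -/
lemma isGaussianProcess_of_linearCombinations [IsProbabilityMeasure P] {X : T → Ω → ℝ}
    (hX : ∀ t, AEMeasurable (X t) P)
    (h : ∀ (n : ℕ) (c : Fin n → ℝ) (t : Fin n → T),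
      ∃ (μ : ℝ) (v : ℝ≥0), P.map (fun ω => ∑ i, c i * X (t i) ω) = gaussianReal μ v) :
    IsGaussianProcess X P := by
  classical
  refine ⟨fun I => ⟨isGaussian_of_map_eq_gaussianReal fun L => ?_⟩⟩
  let e := Fintype.equivFin I
  obtain ⟨μ, v, hv⟩ := h (Fintype.card I) (fun i => L (Pi.single (e.symm i) 1))
    fun i => (e.symm i : T)
  refine ⟨μ, v, ?_⟩
  have hm : AEMeasurable (fun ω => I.restrict (X · ω)) P := aemeasurable_pi_lambda _ fun _ => hX _
  rw [← hv, AEMeasurable.map_map_of_aemeasurable (by fun_prop) hm]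
  congr 1
  ext ω
  rw [e.symm.sum_comp (fun j => L (Pi.single j 1) * X (j : T) ω), Function.comp_apply,
    apply_eq_sum_single_mul]
  rfl

/-- Finite linear combinations of a Gaussian process are Gaussian. -/
lemma hasGaussianLaw_sum_mul {ι : Type*} {X : T → Ω → ℝ} (hX : IsGaussianProcess X P)
    (s : Finset ι) (c : ι → ℝ) (t : ι → T) :
    HasGaussianLaw (fun ω => ∑ i ∈ s, c i * X (t i) ω) P := by
  classical
  let L : (s.image t → ℝ) →L[ℝ] ℝ := ∑ i ∈ s.attach,
    c i • ContinuousLinearMap.proj (R := ℝ) (φ := fun _ : s.image t => ℝ)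
      ⟨t i, Finset.mem_image_of_mem t i.2⟩
  have hL : (fun ω => ∑ i ∈ s, c i * X (t i) ω) =
      fun ω => L ((s.image t).restrict (X · ω)) := by
    ext ω
    rw [← Finset.sum_attach]
    simp [L]
  rw [hL]
  exact (hX.hasGaussianLaw (s.image t)).map_fun L

lemma memLp_two {X : T → Ω → ℝ} (hX : IsGaussianProcess X P) (t : T) : MemLp (X t) 2 P :=
  (hX.hasGaussianLaw_eval t).memLp_two

lemma covariance_sum_mul_sum_mul {ι κ : Type*} {X : T → Ω → ℝ}
    (hX : IsGaussianProcess X P) (s : Finset ι) (s' : Finset κ) (c : ι → ℝ) (d : κ → ℝ)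
    (t : ι → T) (t' : κ → T) :
    cov[fun ω => ∑ i ∈ s, c i * X (t i) ω, fun ω => ∑ j ∈ s', d j * X (t' j) ω; P] =
      ∑ i ∈ s, ∑ j ∈ s', c i * d j * cov[X (t i), X (t' j); P] := by
  have := (hX.hasGaussianLaw ∅).isProbabilityMeasure
  rw [covariance_fun_sum_fun_sum' (fun i _ => (memLp_two hX _).const_mul _)
    (fun i _ => (memLp_two hX _).const_mul _)]
  refine Finset.sum_congr rfl fun i _ => Finset.sum_congr rfl fun j _ => ?_
  rw [covariance_const_mul_left, covariance_const_mul_right, mul_assoc]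

lemma variance_sum_mul {ι : Type*} {X : T → Ω → ℝ}
    (hX : IsGaussianProcess X P) (s : Finset ι) (c : ι → ℝ) (t : ι → T) :
    Var[fun ω => ∑ i ∈ s, c i * X (t i) ω; P] =
      ∑ i ∈ s, ∑ j ∈ s, c i * c j * cov[X (t i), X (t j); P] := by
  rw [← covariance_self (hasGaussianLaw_sum_mul hX s c t).aemeasurable,
    covariance_sum_mul_sum_mul hX]

lemma integral_sum_mul {ι : Type*} {X : T → Ω → ℝ}
    (hX : IsGaussianProcess X P) (s : Finset ι) (c : ι → ℝ) (t : ι → T) :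
    ∫ ω, ∑ i ∈ s, c i * X (t i) ω ∂P = ∑ i ∈ s, c i * ∫ ω, X (t i) ω ∂P := by
  rw [integral_finsetSum _ fun i _ =>
    ((hX.hasGaussianLaw_eval _).integrable.const_mul _)]
  simp_rw [integral_const_mul]

/-- Gaussian processes with the same mean and covariance functions have the same
finite-dimensional distributions. -/
lemma map_eq_of_mean_eq_of_covariance_eq {X : T → Ω → ℝ} {Y : T → Ω' → ℝ}
    [IsProbabilityMeasure P] [IsProbabilityMeasure P']
    (hX : IsGaussianProcess X P) (hY : IsGaussianProcess Y P')
    (hm : ∀ t, ∫ ω, X t ω ∂P = ∫ ω, Y t ω ∂P')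
    (hc : ∀ s t, cov[X s, X t; P] = cov[Y s, Y t; P']) {n : ℕ} (t : Fin n → T) :
    P.map (fun ω i => X (t i) ω) = P'.map (fun ω i => Y (t i) ω) := by
  have hXm : AEMeasurable (fun ω i => X (t i) ω) P :=
    aemeasurable_pi_lambda _ fun _ => hX.aemeasurable _
  have hYm : AEMeasurable (fun ω i => Y (t i) ω) P' :=
    aemeasurable_pi_lambda _ fun _ => hY.aemeasurable _
  have := Measure.isProbabilityMeasure_map hXm
  have := Measure.isProbabilityMeasure_map hYm
  refine Measure.ext_of_charFunDual (funext fun L => ?_)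
  rw [charFunDual_eq_charFun_map_one, charFunDual_eq_charFun_map_one,
    AEMeasurable.map_map_of_aemeasurable (by fun_prop) hXm,
    AEMeasurable.map_map_of_aemeasurable (by fun_prop) hYm]
  have hLX : (L ∘ fun ω i => X (t i) ω) = fun ω => ∑ i, L (Pi.single i 1) * X (t i) ω :=
    funext fun ω => apply_eq_sum_single_mul L _
  have hLY : (L ∘ fun ω i => Y (t i) ω) = fun ω => ∑ i, L (Pi.single i 1) * Y (t i) ω :=
    funext fun ω => apply_eq_sum_single_mul L _
  rw [hLX, hLY, (hasGaussianLaw_sum_mul hX _ _ t).map_eq_gaussianReal,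
    (hasGaussianLaw_sum_mul hY _ _ t).map_eq_gaussianReal]
  simp only [variance_sum_mul hX, variance_sum_mul hY, integral_sum_mul hX, integral_sum_mul hY,
    hm, hc]

/-- An almost sure limit of centered Gaussian variables with convergent variances is a centered
Gaussian variable. -/
lemma map_eq_gaussianReal_of_tendsto {Y : ℕ → Ω → ℝ} {Z : Ω → ℝ} {V : ℝ}
    (hY : ∀ n, HasGaussianLaw (Y n) P) (hmean : ∀ n, ∫ ω, Y n ω ∂P = 0)
    (hvar : Tendsto (fun n => Var[Y n; P]) atTop (𝓝 V))
    (hZ : ∀ᵐ ω ∂P, Tendsto (fun n => Y n ω) atTop (𝓝 (Z ω))) :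
    P.map Z = gaussianReal 0 V.toNNReal := by
  have hP := (hY 0).isProbabilityMeasure
  have hZm : AEMeasurable Z P := aemeasurable_of_tendsto_metrizable_ae' (fun n => (hY n).aemeasurable) hZ
  have := Measure.isProbabilityMeasure_map hZm
  have hV : 0 ≤ V := ge_of_tendsto' hvar fun n => variance_nonneg _ _
  refine Measure.ext_of_charFun (funext fun θ => ?_)
  have h1 : Tendsto (fun n => charFun (P.map (Y n)) θ) atTop (𝓝 (charFun (P.map Z) θ)) := by
    simp_rw [charFun_apply_real]
    have key : ∀ {W : Ω → ℝ}, AEMeasurable W P →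
        ∫ x, Complex.exp (θ * x * Complex.I) ∂(P.map W) =
          ∫ ω, Complex.exp (θ * W ω * Complex.I) ∂P := fun hW =>
      integral_map hW (by fun_prop)
    rw [key hZm]
    simp_rw [fun n => key (hY n).aemeasurable]
    refine tendsto_integral_of_dominated_convergence (fun _ => 1) (fun n => ?_)
      (integrable_const _) (fun n => ae_of_all _ fun ω => ?_) ?_
    · have := (hY n).aemeasurable
      exact AEMeasurable.aestronglyMeasurable (by fun_prop)
    · rw [← Complex.ofReal_mul, Complex.norm_exp_ofReal_mul_I]
    · filter_upwards [hZ] with ω hω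
      have hc : Continuous fun x : ℝ => Complex.exp (θ * x * Complex.I) := by fun_prop
      exact (hc.tendsto _).comp hω
  refine tendsto_nhds_unique h1 ?_
  simp_rw [fun n => (hY n).map_eq_gaussianReal, charFun_gaussianReal, hmean]
  have hc : Continuous fun v : ℝ =>
      Complex.exp (θ * (0 : ℝ) * Complex.I - (v.toNNReal : ℝ) * θ ^ 2 / 2) := by
    have := continuous_real_toNNReal
    fun_prop
  exact (hc.tendsto V).comp hvar

/-- An almost sure limit of centered Gaussian processes with convergent covariances is a centered
Gaussian process, whose covariance is the limit. -/
lemma isGaussianProcess_of_tendsto {X : ℕ → T → Ω → ℝ} {Y : T → Ω → ℝ} {K : T → T → ℝ}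
    [IsProbabilityMeasure P]
    (hX : ∀ n, IsGaussianProcess (X n) P) (hmean : ∀ n t, ∫ ω, X n t ω ∂P = 0)
    (hcov : ∀ s t, Tendsto (fun n => cov[X n s, X n t; P]) atTop (𝓝 (K s t)))
    (hY : ∀ t, ∀ᵐ ω ∂P, Tendsto (fun n => X n t ω) atTop (𝓝 (Y t ω))) :
    IsGaussianProcess Y P ∧ (∀ t, ∫ ω, Y t ω ∂P = 0) ∧ ∀ s t, cov[Y s, Y t; P] = K s t := by
  have hYm : ∀ t, AEMeasurable (Y t) P := fun t =>
    aemeasurable_of_tendsto_metrizable_ae' (fun n => (hX n).aemeasurable t) (hY t)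
  have law : ∀ (n : ℕ) (c : Fin n → ℝ) (t : Fin n → T),
      P.map (fun ω => ∑ i, c i * Y (t i) ω) =
        gaussianReal 0 (∑ i, ∑ j, c i * c j * K (t i) (t j)).toNNReal := by
    intro n c t
    refine map_eq_gaussianReal_of_tendsto (Y := fun N ω => ∑ i, c i * X N (t i) ω)
      (fun N => hasGaussianLaw_sum_mul (hX N) _ _ _) (fun N => ?_) ?_ ?_
    · simp [integral_sum_mul (hX N), hmean]
    · simp_rw [fun N => variance_sum_mul (hX N) Finset.univ c t]
      exact tendsto_finsetSum _ fun i _ => tendsto_finsetSum _ fun j _ =>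
        (hcov _ _).const_mul _
    · filter_upwards [ae_all_iff.2 fun i => hY (t i)] with ω hω
      exact tendsto_finsetSum _ fun i _ => (hω i).const_mul _
  have hYG := isGaussianProcess_of_linearCombinations hYm fun n c t => ⟨_, _, law n c t⟩
  have hK : ∀ (n : ℕ) (c : Fin n → ℝ) (t : Fin n → T),
      0 ≤ ∑ i, ∑ j, c i * c j * K (t i) (t j) := fun n c t => by
    refine ge_of_tendsto' (tendsto_finsetSum _ fun i _ => tendsto_finsetSum _ fun j _ =>
        (hcov (t i) (t j)).const_mul (c i * c j)) fun N => ?_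
    rw [← variance_sum_mul (hX N)]
    exact variance_nonneg _ _
  have hvar : ∀ (n : ℕ) (c : Fin n → ℝ) (t : Fin n → T),
      ∑ i, ∑ j, c i * c j * cov[Y (t i), Y (t j); P] =
        ∑ i, ∑ j, c i * c j * K (t i) (t j) := fun n c t => by
    have h := variance_map (μ := P) (X := id) (Y := fun ω => ∑ i, c i * Y (t i) ω)
      aemeasurable_id (hasGaussianLaw_sum_mul hYG _ _ _).aemeasurable
    rw [law, variance_id_gaussianReal, Function.id_comp, variance_sum_mul hYG,
      Real.coe_toNNReal _ (hK n c t)] at h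
    exact h.symm
  have hself : ∀ t, cov[Y t, Y t; P] = K t t := fun t => by
    simpa using hvar 1 (fun _ => 1) (fun _ => t)
  have hKsymm : ∀ s t, K s t = K t s := fun s t =>
    tendsto_nhds_unique (hcov s t) (by simpa only [covariance_comm] using hcov t s)
  refine ⟨hYG, fun t => ?_, fun s t => ?_⟩
  · have h := law 1 (fun _ => 1) fun _ => t
    simp only [Finset.univ_unique, Finset.sum_singleton, one_mul] at h
    have h' : ∫ x, x ∂(P.map (Y t)) = 0 := by
      change ∫ x, x ∂(P.map fun ω => Y t ω) = 0
      rw [h, integral_id_gaussianReal]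
    rwa [integral_map (hYm t) (by fun_prop)] at h'
  · have h := hvar 2 (fun _ => 1) ![s, t]
    simp only [Fin.sum_univ_two, Matrix.cons_val_zero, Matrix.cons_val_one, hself, one_mul,
      covariance_comm (Y t) (Y s), hKsymm t s] at h
    linarith

end GaussianProcesses

section ConditionalIndependence

lemma condExp_mul_of_condIndepFun {Ω : Type*} {m mΩ : MeasurableSpace Ω} [StandardBorelSpace Ω]
    {P : Measure Ω} [IsFiniteMeasure P] (hm : m ≤ mΩ) {f g : Ω → ℝ} (hf : Measurable f)
    (hg : Measurable g) (hfi : Integrable f P) (hgi : Integrable g P)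
    (hfgi : Integrable (fun ω => f ω * g ω) P) (h : CondIndepFun m hm f g P) :
    P[fun ω => f ω * g ω | m] =ᵐ[P] fun ω => (P[f | m]) ω * (P[g | m]) ω := by
  have hprod := ae_of_ae_trim hm ((condIndepFun_iff_map_prod_eq_prod_map_map hf hg).1 h)
  filter_upwards [hprod, condExp_ae_eq_integral_condExpKernel hm hfi,
    condExp_ae_eq_integral_condExpKernel hm hgi,
    condExp_ae_eq_integral_condExpKernel hm hfgi] with ω hω hf' hg' hfg'
  rw [hf', hg', hfg']
  rw [Kernel.map_apply _ (hf.prodMk hg), Kernel.prod_apply, Kernel.map_apply _ hf,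
    Kernel.map_apply _ hg] at hω
  have h1 : ∫ y, f y * g y ∂(condExpKernel P m ω) =
      ∫ z : ℝ × ℝ, z.1 * z.2 ∂((condExpKernel P m ω).map fun ω => (f ω, g ω)) :=
    (integral_map (f := fun z : ℝ × ℝ => z.1 * z.2) (hf.prodMk hg).aemeasurable
      (by fun_prop)).symm
  rw [h1, hω, integral_prod_mul (fun x : ℝ => x) (fun x : ℝ => x),
    integral_map hf.aemeasurable (by fun_prop), integral_map hg.aemeasurable (by fun_prop)]

variable {Ω : Type*} [mΩ : MeasurableSpace Ω] {P : Measure Ω}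

/-- Gaussian regression: the conditional expectation of a Gaussian variable given another one. -/
lemma condExp_eq_of_hasGaussianLaw {X Y : Ω → ℝ} (hX : Measurable X) (hY : Measurable Y)
    (hXY : HasGaussianLaw (fun ω => (X ω, Y ω)) P) (hv : Var[Y; P] ≠ 0) :
    P[X | MeasurableSpace.comap Y inferInstance] =ᵐ[P]
      fun ω => cov[X, Y; P] / Var[Y; P] * (Y ω - P[Y]) + P[X] := by
  have := hXY.isProbabilityMeasure
  set α := cov[X, Y; P] / Var[Y; P] with hα
  have hXg : HasGaussianLaw X P := hXY.fst
  have hYg : HasGaussianLaw Y P := hXY.snd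
  have hDY : HasGaussianLaw (fun ω => (X ω - α * Y ω, Y ω)) P := by
    let L : ℝ × ℝ →L[ℝ] ℝ × ℝ :=
      (ContinuousLinearMap.fst ℝ ℝ ℝ - α • ContinuousLinearMap.snd ℝ ℝ ℝ).prod
        (ContinuousLinearMap.snd ℝ ℝ ℝ)
    exact hXY.map_fun L
  have hcov : cov[fun ω => X ω - α * Y ω, Y; P] = 0 := by
    rw [covariance_fun_sub_left hXg.memLp_two (hYg.memLp_two.const_mul _) hYg.memLp_two,
      covariance_const_mul_left, covariance_self hYg.aemeasurable, hα, div_mul_cancel₀ _ hv,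
      sub_self]
  have hind := hDY.indepFun_of_covariance_eq_zero hcov
  have hDi : Integrable (fun ω => X ω - α * Y ω) P := hDY.fst.integrable
  have hsplit : X = (fun ω => X ω - α * Y ω) + fun ω => α * Y ω := by
    ext ω; simp
  have h1 := condExp_indep_eq (m₁ := MeasurableSpace.comap (fun ω => X ω - α * Y ω) inferInstance)
    (m₂ := MeasurableSpace.comap Y inferInstance) (μ := P) (f := fun ω => X ω - α * Y ω)
    (hX.sub (hY.const_mul α)).comap_le hY.comap_le
    (comap_measurable _).stronglyMeasurable hind
  have h2 : P[fun ω => α * Y ω | MeasurableSpace.comap Y inferInstance] = fun ω => α * Y ω :=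
    condExp_of_stronglyMeasurable hY.comap_le
      ((comap_measurable Y).const_mul α).stronglyMeasurable (hYg.integrable.const_mul α)
  have h3 := condExp_add hDi (hYg.integrable.const_mul α) (MeasurableSpace.comap Y inferInstance)
  rw [← hsplit] at h3
  filter_upwards [h1, h3] with ω h1 h3
  rw [h3, Pi.add_apply, h1, h2, integral_sub hXg.integrable (hYg.integrable.const_mul α),
    integral_const_mul]
  ring

/-- Covariances of Gaussian variables factor through a variable given which they are
conditionally independent. -/
lemma covariance_mul_variance_eq_of_condIndepFun [StandardBorelSpace Ω] [IsFiniteMeasure P]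
    {X Y W : Ω → ℝ} (hX : Measurable X) (hY : Measurable Y) (hW : Measurable W)
    (hXY : HasGaussianLaw (fun ω => (X ω, Y ω)) P) (hWY : HasGaussianLaw (fun ω => (W ω, Y ω)) P)
    (hv : Var[Y; P] ≠ 0) (h : X ⟂ᵢ[Y, hY; P] W) :
    cov[X, W; P] * Var[Y; P] = cov[X, Y; P] * cov[Y, W; P] := by
  have hprob := hXY.isProbabilityMeasure
  have hX2 : MemLp X 2 P := hXY.fst.memLp_two
  have hW2 : MemLp W 2 P := hWY.fst.memLp_two
  have hY2 : MemLp Y 2 P := hXY.snd.memLp_two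
  have hmul := condExp_mul_of_condIndepFun hY.comap_le hX hW (hX2.integrable one_le_two)
    (hW2.integrable one_le_two) (hX2.integrable_mul hW2) h
  set α := cov[X, Y; P] / Var[Y; P] with hα
  set β := cov[W, Y; P] / Var[Y; P] with hβ
  have hYc : ∫ ω, (Y ω - P[Y]) ∂P = 0 := by
    rw [integral_sub (hY2.integrable one_le_two) (integrable_const _)]
    simp
  have hYv : ∫ ω, (Y ω - P[Y]) ^ 2 ∂P = Var[Y; P] := (variance_eq_integral hY.aemeasurable).symm
  have hYd : MemLp (fun ω => Y ω - P[Y]) 2 P := hY2.sub (memLp_const _)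
  have hE : P[X * W] = α * β * Var[Y; P] + P[X] * P[W] := by
    calc P[X * W] = ∫ ω, (P[fun ω => X ω * W ω | MeasurableSpace.comap Y inferInstance]) ω ∂P :=
          (integral_condExp hY.comap_le).symm
      _ = ∫ ω, (α * β * (Y ω - P[Y]) ^ 2 + (α * P[W] + β * P[X]) * (Y ω - P[Y])
            + P[X] * P[W]) ∂P := by
          refine integral_congr_ae ?_
          filter_upwards [hmul, condExp_eq_of_hasGaussianLaw hX hY hXY hv,
            condExp_eq_of_hasGaussianLaw hW hY hWY hv] with ω h1 h2 h3
          rw [h1, h2, h3]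
          ring
      _ = _ := by
          have hi1 := hYd.integrable_sq.const_mul (α * β)
          have hi2 := (hYd.integrable one_le_two).const_mul (α * P[W] + β * P[X])
          have hi3 : Integrable (fun ω => α * β * (Y ω - P[Y]) ^ 2 +
              (α * P[W] + β * P[X]) * (Y ω - P[Y])) P := hi1.add hi2
          rw [integral_add hi3 (integrable_const _), integral_add hi1 hi2,
            integral_const_mul, integral_const_mul, hYc, hYv]
          simp
  rw [covariance_eq_sub hX2 hW2, hE, hα, hβ, covariance_comm Y W]
  field_simp
  ring

end ConditionalIndependence

section Continuity

variable {Ω T : Type*} [mΩ : MeasurableSpace Ω] {P : Measure Ω}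

lemma tendsto_integral_and_variance_of_ae_tendsto_zero {ι : Type*} {l : Filter ι}
    [l.IsCountablyGenerated] [IsProbabilityMeasure P] {D : ι → Ω → ℝ}
    (hD : ∀ i, HasGaussianLaw (D i) P) (h : ∀ᵐ ω ∂P, Tendsto (fun i => D i ω) l (𝓝 0)) :
    Tendsto (fun i => ∫ ω, D i ω ∂P) l (𝓝 0) ∧ Tendsto (fun i => Var[D i; P]) l (𝓝 0) := by
  have hvar : Tendsto (fun i => Var[D i; P]) l (𝓝 0) := by
    have h1 : Tendsto (fun i => ∫ ω, Complex.exp (D i ω * Complex.I) ∂P) l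
        (𝓝 (∫ _, (1 : ℂ) ∂P)) := by
      refine tendsto_integral_filter_of_dominated_convergence (fun _ => 1)
        (Eventually.of_forall fun i => ?_)
        (Eventually.of_forall fun i => ae_of_all _ fun ω => ?_) (integrable_const _) ?_
      · have := (hD i).aemeasurable
        exact AEMeasurable.aestronglyMeasurable (by fun_prop)
      · rw [Complex.norm_exp_ofReal_mul_I]
      · filter_upwards [h] with ω hω
        have hc : Continuous fun x : ℝ => Complex.exp (x * Complex.I) := by fun_prop
        simpa [Function.comp_def] using (hc.tendsto 0).comp hω
    have h2 : ∀ i, ‖∫ ω, Complex.exp (D i ω * Complex.I) ∂P‖ = Real.exp (-(Var[D i; P] / 2)) := by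
      intro i
      have h3 := charFun_gaussianReal (μ := P[D i]) (v := Var[D i; P].toNNReal) 1
      rw [← (hD i).map_eq_gaussianReal, charFun_apply_real,
        integral_map (hD i).aemeasurable (by fun_prop)] at h3
      simp only [Complex.ofReal_one, one_mul] at h3
      rw [h3, Complex.norm_exp]
      simp [variance_nonneg]
    have h4 := h1.norm
    simp only [h2, integral_const, probReal_univ, one_smul, norm_one] at h4
    have h5 := ((Real.continuousAt_log one_ne_zero).tendsto.comp h4).const_mul (-2)
    simp only [Function.comp_def, Real.log_exp, Real.log_one, mul_zero] at h5
    refine h5.congr fun i => by ring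
  refine ⟨?_, hvar⟩
  have h1 : Tendsto (fun i => ∫ ω, min (D i ω ^ 2) 1 ∂P) l (𝓝 (∫ _, (0 : ℝ) ∂P)) := by
    refine tendsto_integral_filter_of_dominated_convergence (fun _ => 1)
      (Eventually.of_forall fun i => ?_)
      (Eventually.of_forall fun i => ae_of_all _ fun ω => ?_) (integrable_const _) ?_
    · have := (hD i).aemeasurable
      exact AEMeasurable.aestronglyMeasurable (by fun_prop)
    · rw [Real.norm_of_nonneg (by positivity)]
      exact min_le_right _ _
    · filter_upwards [h] with ω hω
      have hc : Continuous fun x : ℝ => min (x ^ 2) 1 := by fun_prop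
      simpa [Function.comp_def] using (hc.tendsto 0).comp hω
  have h2 : ∀ i, min ((∫ ω, D i ω ∂P) ^ 2) 1 ≤
      2 * (∫ ω, min (D i ω ^ 2) 1 ∂P) + 2 * Var[D i; P] := by
    intro i
    have hi1 : Integrable (fun ω => min (D i ω ^ 2) 1) P := by
      refine Integrable.of_bound (C := 1) ?_ (ae_of_all _ fun ω => ?_)
      · have := (hD i).aemeasurable
        exact AEMeasurable.aestronglyMeasurable (by fun_prop)
      · rw [Real.norm_of_nonneg (by positivity)]
        exact min_le_right _ _
    have hi2 : Integrable (fun ω => (D i ω - P[D i]) ^ 2) P :=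
      ((hD i).memLp_two.sub (memLp_const _)).integrable_sq
    rw [variance_eq_integral (hD i).aemeasurable, ← integral_const_mul, ← integral_const_mul,
      ← integral_add (hi1.const_mul 2) (hi2.const_mul 2)]
    have h3 : min ((∫ ω, D i ω ∂P) ^ 2) 1 = ∫ _, min ((∫ ω, D i ω ∂P) ^ 2) 1 ∂P := by simp
    rw [h3]
    refine integral_mono (integrable_const _) ((hi1.const_mul 2).add (hi2.const_mul 2))
      fun ω => ?_
    dsimp only
    rcases min_cases (D i ω ^ 2) 1 with ⟨h, _⟩ | ⟨h, _⟩ <;> rw [h]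
    · exact (min_le_left _ _).trans (by nlinarith [sq_nonneg (2 * D i ω - P[D i])])
    · exact (min_le_right _ _).trans (by nlinarith [sq_nonneg (D i ω - P[D i])])
  have h3 : Tendsto (fun i => min ((∫ ω, D i ω ∂P) ^ 2) 1) l (𝓝 0) := by
    refine squeeze_zero (fun i => by positivity) h2 ?_
    simpa using (h1.const_mul 2).add (hvar.const_mul 2)
  have h4 : Tendsto (fun i => (∫ ω, D i ω ∂P) ^ 2) l (𝓝 0) := by
    refine h3.congr' ?_
    filter_upwards [h3.eventually (gt_mem_nhds one_pos)] with i hi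
    rcases min_lt_iff.1 hi with hi | hi
    · exact min_eq_left hi.le
    · exact absurd hi (lt_irrefl _)
  have h5 := h4.sqrt
  simp only [Real.sqrt_sq_eq_abs, Real.sqrt_zero] at h5
  exact tendsto_zero_iff_abs_tendsto_zero _ |>.2 h5

lemma covariance_sq_le [IsProbabilityMeasure P] {X Y : Ω → ℝ} (hX : MemLp X 2 P) (hY : MemLp Y 2 P) :
    cov[X, Y; P] ^ 2 ≤ Var[X; P] * Var[Y; P] := by
  have h : ∀ x : ℝ, 0 ≤ Var[X; P] * (x * x) + 2 * cov[X, Y; P] * x + Var[Y; P] := fun x => by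
    have h1 := variance_nonneg (fun ω => x * X ω + Y ω) P
    rw [variance_fun_add (hX.const_mul x) hY, variance_const_mul, covariance_const_mul_left] at h1
    linarith
  have h2 := discrim_le_zero h
  rw [discrim] at h2
  linarith

variable [TopologicalSpace T] [FirstCountableTopology T] {X : T → Ω → ℝ}

lemma continuous_integral_of_ae_continuous (hX : IsGaussianProcess X P)
    (hc : ∀ᵐ ω ∂P, Continuous fun t => X t ω) : Continuous fun t => ∫ ω, X t ω ∂P := by
  have := (hX.hasGaussianLaw ∅).isProbabilityMeasure
  refine continuous_iff_continuousAt.2 fun t => ?_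
  have h := (tendsto_integral_and_variance_of_ae_tendsto_zero (l := 𝓝 t)
    (fun s => hX.hasGaussianLaw_sub (s := s) (t := t)) (by
      filter_upwards [hc] with ω hω
      simpa using (hω.tendsto t).sub_const (X t ω))).1
  have h2 := h.add_const (∫ ω, X t ω ∂P)
  rw [zero_add] at h2
  refine h2.congr fun s => ?_
  simp only [Pi.sub_apply]
  rw [integral_sub (hX.hasGaussianLaw_eval s).integrable (hX.hasGaussianLaw_eval t).integrable]
  ring

lemma tendsto_variance_sub_of_ae_continuous (hX : IsGaussianProcess X P)
    (hc : ∀ᵐ ω ∂P, Continuous fun t => X t ω) (t : T) :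
    Tendsto (fun s => Var[X s - X t; P]) (𝓝 t) (𝓝 0) := by
  have := (hX.hasGaussianLaw ∅).isProbabilityMeasure
  exact (tendsto_integral_and_variance_of_ae_tendsto_zero (l := 𝓝 t)
    (fun s => hX.hasGaussianLaw_sub (s := s) (t := t)) (by
      filter_upwards [hc] with ω hω
      simpa using (hω.tendsto t).sub_const (X t ω))).2

lemma continuous_covariance_of_ae_continuous (hX : IsGaussianProcess X P)
    (hc : ∀ᵐ ω ∂P, Continuous fun t => X t ω) (r : T) :
    Continuous fun t => cov[X r, X t; P] := by
  have := (hX.hasGaussianLaw ∅).isProbabilityMeasure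
  refine continuous_iff_continuousAt.2 fun t => ?_
  rw [ContinuousAt, tendsto_iff_dist_tendsto_zero]
  have h := ((tendsto_variance_sub_of_ae_continuous hX hc t).const_mul Var[X r; P]).sqrt
  rw [mul_zero, Real.sqrt_zero] at h
  refine squeeze_zero (fun _ => dist_nonneg) (fun s => ?_) h
  rw [Real.dist_eq, ← covariance_sub_right (memLp_two hX r) (memLp_two hX s) (memLp_two hX t)]
  exact Real.abs_le_sqrt (covariance_sq_le (memLp_two hX r)
    ((memLp_two hX s).sub (memLp_two hX t)))

lemma continuous_variance_of_ae_continuous (hX : IsGaussianProcess X P)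
    (hc : ∀ᵐ ω ∂P, Continuous fun t => X t ω) :
    Continuous fun t => Var[X t; P] := by
  have := (hX.hasGaussianLaw ∅).isProbabilityMeasure
  refine continuous_iff_continuousAt.2 fun t => ?_
  have h := ((tendsto_variance_sub_of_ae_continuous hX hc t).add
    (((continuous_covariance_of_ae_continuous hX hc t).tendsto t).const_mul 2)).sub_const Var[X t; P]
  rw [covariance_self (hX.aemeasurable t)] at h
  have h0 : 0 + 2 * Var[X t; P] - Var[X t; P] = Var[X t; P] := by ring
  rw [h0] at h
  refine h.congr fun s => ?_
  rw [variance_sub (memLp_two hX s) (memLp_two hX t), covariance_comm (X t) (X s)]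
  ring

end Continuity

section Kernel

lemma pos_of_factorization {a b : ℝ} {R : ℝ → ℝ → ℝ}
    (hcont : ∀ r ∈ Icc a b, ContinuousOn (R r) (Icc a b)) (hsymm : ∀ s t, R s t = R t s)
    (hpos : ∀ t ∈ Icc a b, 0 < R t t)
    (hfac : ∀ s t u, a ≤ s → s ≤ t → t ≤ u → u ≤ b → R s u * R t t = R s t * R t u)
    {t : ℝ} (ht : t ∈ Icc a b) : 0 < R a t := by
  have hab : a ≤ b := ht.1.trans ht.2
  have ha : a ∈ Icc a b := left_mem_Icc.2 hab
  have hne : ∀ t ∈ Icc a b, R a t ≠ 0 := by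
    intro t ht h0
    set S := Icc a b ∩ R a ⁻¹' {0}
    have hS : IsClosed S := (hcont a ha).preimage_isClosed_of_isClosed isClosed_Icc isClosed_singleton
    have hSb : BddBelow S := ⟨a, fun x hx => hx.1.1⟩
    have hmem : sInf S ∈ S := hS.csInf_mem ⟨t, ht, h0⟩ hSb
    set τ := sInf S
    have hτ0 : R a τ = 0 := hmem.2
    have haτ : a < τ := lt_of_le_of_ne hmem.1.1 fun h => (hpos a ha).ne' (by rw [← h] at hτ0; exact hτ0)
    have hz : ∀ r ∈ Ico a τ, R τ r = 0 := by
      intro r hr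
      have hrb : r ≤ b := hr.2.le.trans hmem.1.2
      have hra : R a r ≠ 0 := fun h => notMem_of_lt_csInf hr.2 hSb ⟨⟨hr.1, hrb⟩, h⟩
      have h1 := hfac a r τ le_rfl hr.1 hr.2.le hmem.1.2
      rw [hτ0, zero_mul] at h1
      rw [hsymm]
      exact (mul_eq_zero.1 h1.symm).resolve_left hra
    have h1 : Tendsto (R τ) (𝓝[Ico a τ] τ) (𝓝 (R τ τ)) :=
      ((hcont τ hmem.1) τ hmem.1).mono_left
        (nhdsWithin_mono _ fun r hr => ⟨hr.1, hr.2.le.trans hmem.1.2⟩)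
    have h2 : Tendsto (R τ) (𝓝[Ico a τ] τ) (𝓝 0) :=
      tendsto_const_nhds.congr' (eventually_nhdsWithin_of_forall fun r hr => (hz r hr).symm)
    have : (𝓝[Ico a τ] τ).NeBot := by
      rw [← mem_closure_iff_nhdsWithin_neBot, closure_Ico haτ.ne]
      exact right_mem_Icc.2 haτ.le
    exact (hpos τ hmem.1).ne' (tendsto_nhds_unique h1 h2)
  by_contra! h
  obtain ⟨x, hx, hx0⟩ := intermediate_value_Icc' ht.1
    ((hcont a ha).mono (Icc_subset_Icc_right ht.2)) (show (0 : ℝ) ∈ Icc (R a t) (R a a) from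
      ⟨h, (hpos a ha).le⟩)
  exact hne x ⟨hx.1, hx.2.trans ht.2⟩ hx0

/-- A continuous factorizing covariance function on `[a, b]` is that of a space-time scaled
Brownian motion. -/
lemma exists_eq_mul_mul_of_factorization {a b : ℝ} {R : ℝ → ℝ → ℝ} (hab : a ≤ b)
    (hcont : ∀ r ∈ Icc a b, ContinuousOn (R r) (Icc a b))
    (hdiag : ContinuousOn (fun t => R t t) (Icc a b)) (hsymm : ∀ s t, R s t = R t s)
    (hpos : ∀ t ∈ Icc a b, 0 < R t t)
    (hCS : ∀ s ∈ Icc a b, ∀ t ∈ Icc a b, R s t ^ 2 ≤ R s s * R t t)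
    (hfac : ∀ s t u, a ≤ s → s ≤ t → t ≤ u → u ≤ b → R s u * R t t = R s t * R t u) :
    ∃ u v : ℝ → ℝ, ContinuousOn u (Icc a b) ∧ ContinuousOn v (Icc a b) ∧
      (∀ t ∈ Icc a b, 0 < u t) ∧ (∀ t ∈ Icc a b, 0 < v t) ∧ MonotoneOn v (Icc a b) ∧
      ∀ s ∈ Icc a b, ∀ t ∈ Icc a b, R s t = u s * u t * min (v s) (v t) := by
  have ha : a ∈ Icc a b := left_mem_Icc.2 hab
  have hu : ∀ t ∈ Icc a b, 0 < R a t := fun t ht => pos_of_factorization hcont hsymm hpos hfac ht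
  have hmono : MonotoneOn (fun t => R t t / R a t ^ 2) (Icc a b) := by
    intro s hs t ht hst
    have h1 := hfac a s t le_rfl hs.1 hst ht.2
    have hus := hu s hs
    have hut := hu t ht
    have hss := hpos s hs
    have h2 : R s s * R a t ^ 2 ≤ R t t * R a s ^ 2 := by
      refine le_of_mul_le_mul_left ?_ hss
      calc R s s * (R s s * R a t ^ 2) = R a s ^ 2 * R s t ^ 2 := by
            rw [← mul_pow, ← h1]; ring
        _ ≤ R a s ^ 2 * (R s s * R t t) := by gcongr; exact hCS s hs t ht
        _ = _ := by ring
    exact (div_le_div_iff₀ (by positivity) (by positivity)).2 h2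
  have key : ∀ s ∈ Icc a b, ∀ t ∈ Icc a b, s ≤ t →
      R s t = R a s * R a t * min (R s s / R a s ^ 2) (R t t / R a t ^ 2) := by
    intro s hs t ht hst
    have hus := (hu s hs).ne'
    rw [min_eq_left (hmono hs ht hst)]
    have h1 := hfac a s t le_rfl hs.1 hst ht.2
    field_simp
    linarith
  refine ⟨R a, fun t => R t t / R a t ^ 2, hcont a ha,
    hdiag.div ((hcont a ha).pow 2) fun t ht => pow_ne_zero 2 (hu t ht).ne', hu,
    fun t ht => div_pos (hpos t ht) (pow_pos (hu t ht) 2), hmono, fun s hs t ht => ?_⟩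
  rcases le_total s t with h | h
  · exact key s hs t ht h
  · rw [hsymm, key t ht s hs h, mul_comm (R a t), min_comm]

end Kernel

section TentFunctions

/-- The tent function on the unit interval. -/
noncomputable def tent (x : ℝ) : ℝ := min x (1 - x)

/-- The covariance function of the Brownian bridge. -/
noncomputable def bridge (x y : ℝ) : ℝ := min x y - x * y

lemma tent_fract_nonneg (x : ℝ) : 0 ≤ tent (Int.fract x) :=
  le_min (Int.fract_nonneg x) (sub_nonneg.2 (Int.fract_lt_one x).le)

lemma tent_fract_le_one (x : ℝ) : tent (Int.fract x) ≤ 1 :=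
  (min_le_left _ _).trans (Int.fract_lt_one x).le

lemma abs_bridge_le_one {x y : ℝ} (hx : x ∈ Ico (0 : ℝ) 1) (hy : y ∈ Ico (0 : ℝ) 1) :
    |bridge x y| ≤ 1 := by
  obtain ⟨hx0, hx1⟩ := hx
  obtain ⟨hy0, hy1⟩ := hy
  rw [bridge, abs_le]
  rcases min_cases x y with ⟨h, _⟩ | ⟨h, _⟩ <;> rw [h] <;> constructor <;> nlinarith

lemma floor_two_mul_of_mem_Ico {p : ℝ} (hp : p ∈ Ico (0 : ℝ) 1) :
    (p < 1 / 2 ∧ ⌊2 * p⌋ = 0) ∨ (1 / 2 ≤ p ∧ ⌊2 * p⌋ = 1) := by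
  rcases lt_or_ge p (1 / 2) with h | h
  · exact Or.inl ⟨h, Int.floor_eq_iff.2 ⟨by simpa using hp.1, by norm_num; linarith⟩⟩
  · exact Or.inr ⟨h, Int.floor_eq_iff.2 ⟨by norm_num; linarith, by norm_num; linarith [hp.2]⟩⟩

lemma tent_of_le {p : ℝ} (h : p ≤ 1 / 2) : tent p = p := min_eq_left (by linarith)

lemma tent_of_ge {p : ℝ} (h : 1 / 2 ≤ p) : tent p = 1 - p := min_eq_right (by linarith)

lemma bridge_of_le {p q : ℝ} (h : p ≤ q) : bridge p q = p - p * q := by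
  rw [bridge, min_eq_left h]

lemma bridge_comm (p q : ℝ) : bridge p q = bridge q p := by
  rw [bridge, bridge, min_comm, mul_comm]

lemma bridge_eq_tent_mul_tent_add {p q : ℝ} (hp : p ∈ Ico (0 : ℝ) 1) (hq : q ∈ Ico (0 : ℝ) 1) :
    bridge p q = tent p * tent q +
      1 / 2 * if ⌊2 * p⌋ = ⌊2 * q⌋ then bridge (Int.fract (2 * p)) (Int.fract (2 * q)) else 0 := by
  wlog hpq : p ≤ q generalizing p q
  · rw [bridge_comm, this hq hp (le_of_not_ge hpq), mul_comm (tent p), bridge_comm (Int.fract _)]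
    simp only [eq_comm]
  rw [Int.fract, Int.fract, bridge_of_le hpq]
  rcases floor_two_mul_of_mem_Ico hp with ⟨h1, e1⟩ | ⟨h1, e1⟩ <;>
    rcases floor_two_mul_of_mem_Ico hq with ⟨h2, e2⟩ | ⟨h2, e2⟩
  · rw [e1, e2, if_pos rfl, tent_of_le h1.le, tent_of_le h2.le, bridge_of_le (by gcongr)]
    push_cast
    ring
  · rw [e1, e2, if_neg zero_ne_one, tent_of_le h1.le, tent_of_ge h2]
    ring
  · linarith
  · rw [e1, e2, if_pos rfl, tent_of_ge h1, tent_of_ge h2, bridge_of_le (by gcongr)]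
    push_cast
    ring

lemma fract_two_pow_succ_mul (N : ℕ) (x : ℝ) :
    Int.fract (2 ^ (N + 1) * x) = Int.fract (2 * Int.fract (2 ^ N * x)) := by
  have : (2 : ℝ) ^ (N + 1) * x = 2 * Int.fract (2 ^ N * x) + ((2 * ⌊(2 : ℝ) ^ N * x⌋ : ℤ) : ℝ) := by
    rw [Int.fract]; push_cast; ring
  rw [this, Int.fract_add_intCast]

lemma floor_two_pow_succ_mul (N : ℕ) (x : ℝ) :
    ⌊(2 : ℝ) ^ (N + 1) * x⌋ = ⌊2 * Int.fract (2 ^ N * x)⌋ + 2 * ⌊(2 : ℝ) ^ N * x⌋ := by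
  have : (2 : ℝ) ^ (N + 1) * x = 2 * Int.fract (2 ^ N * x) + ((2 * ⌊(2 : ℝ) ^ N * x⌋ : ℤ) : ℝ) := by
    rw [Int.fract]; push_cast; ring
  rw [this, Int.floor_add_intCast]

lemma floor_two_pow_succ_mul_eq_iff (N : ℕ) (x y : ℝ) :
    ⌊(2 : ℝ) ^ (N + 1) * x⌋ = ⌊(2 : ℝ) ^ (N + 1) * y⌋ ↔
      ⌊(2 : ℝ) ^ N * x⌋ = ⌊(2 : ℝ) ^ N * y⌋ ∧
        ⌊2 * Int.fract ((2 : ℝ) ^ N * x)⌋ = ⌊2 * Int.fract ((2 : ℝ) ^ N * y)⌋ := by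
  rw [floor_two_pow_succ_mul, floor_two_pow_succ_mul]
  have hx := floor_two_mul_of_mem_Ico ⟨Int.fract_nonneg ((2 : ℝ) ^ N * x), Int.fract_lt_one _⟩
  have hy := floor_two_mul_of_mem_Ico ⟨Int.fract_nonneg ((2 : ℝ) ^ N * y), Int.fract_lt_one _⟩
  omega

lemma bridge_eq_sum_add {x y : ℝ} (hx : x ∈ Ico (0 : ℝ) 1) (hy : y ∈ Ico (0 : ℝ) 1) (N : ℕ) :
    bridge x y = (∑ n ∈ Finset.range N, (1 / 2) ^ n *
        if ⌊(2 : ℝ) ^ n * x⌋ = ⌊(2 : ℝ) ^ n * y⌋ then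
          tent (Int.fract (2 ^ n * x)) * tent (Int.fract (2 ^ n * y)) else 0) +
      (1 / 2) ^ N * if ⌊(2 : ℝ) ^ N * x⌋ = ⌊(2 : ℝ) ^ N * y⌋ then
        bridge (Int.fract (2 ^ N * x)) (Int.fract (2 ^ N * y)) else 0 := by
  induction N with
  | zero =>
    have h1 := Int.floor_eq_zero_iff.2 hx
    have h2 := Int.floor_eq_zero_iff.2 hy
    simp [h1, h2, Int.fract_eq_self.2 hx, Int.fract_eq_self.2 hy]
  | succ N ih =>
    rw [ih, Finset.sum_range_succ, add_assoc, add_right_inj, ← sub_eq_zero]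
    simp only [floor_two_pow_succ_mul_eq_iff, fract_two_pow_succ_mul]
    by_cases h : ⌊(2 : ℝ) ^ N * x⌋ = ⌊(2 : ℝ) ^ N * y⌋
    · simp only [h, if_true, true_and]
      rw [bridge_eq_tent_mul_tent_add ⟨Int.fract_nonneg _, Int.fract_lt_one _⟩
        ⟨Int.fract_nonneg _, Int.fract_lt_one _⟩]
      ring
    · simp [h]

/-- The Lévy–Ciesielski expansion of the covariance of the Brownian bridge. -/
lemma tendsto_sum_tent_mul_tent {x y : ℝ} (hx : x ∈ Ico (0 : ℝ) 1) (hy : y ∈ Ico (0 : ℝ) 1) :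
    Tendsto (fun N => ∑ n ∈ Finset.range N, (1 / 2 : ℝ) ^ n *
        if ⌊(2 : ℝ) ^ n * x⌋ = ⌊(2 : ℝ) ^ n * y⌋ then
          tent (Int.fract (2 ^ n * x)) * tent (Int.fract (2 ^ n * y)) else 0)
      atTop (𝓝 (bridge x y)) := by
  have h0 : Tendsto (fun N => (1 / 2 : ℝ) ^ N * if ⌊(2 : ℝ) ^ N * x⌋ = ⌊(2 : ℝ) ^ N * y⌋ then
        bridge (Int.fract (2 ^ N * x)) (Int.fract (2 ^ N * y)) else 0) atTop (𝓝 0) := by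
    refine squeeze_zero_norm (fun N => ?_)
      (tendsto_pow_atTop_nhds_zero_of_lt_one (r := (1 / 2 : ℝ)) (by norm_num) (by norm_num))
    rw [norm_mul, norm_pow, Real.norm_of_nonneg (by norm_num : (0 : ℝ) ≤ 1 / 2)]
    refine mul_le_of_le_one_right (by positivity) ?_
    split_ifs
    · exact abs_bridge_le_one ⟨Int.fract_nonneg _, Int.fract_lt_one _⟩
        ⟨Int.fract_nonneg _, Int.fract_lt_one _⟩
    · simp
  have h1 := h0.const_sub (bridge x y)
  rw [sub_zero] at h1
  exact h1.congr fun N => by rw [bridge_eq_sum_add hx hy N]; ring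

lemma continuousOn_tent_fract_mul (N : ℕ) (η : ℤ → ℝ) :
    ContinuousOn (fun x : ℝ => tent (Int.fract (2 ^ N * x)) * η ⌊(2 : ℝ) ^ N * x⌋) (Ico 0 1) := by
  have h : ContinuousOn (fun x : ℝ => ∑ k ∈ Finset.range (2 ^ N),
      max 0 (tent (2 ^ N * x - k)) * η k) (Ico 0 1) := by
    unfold tent
    fun_prop
  refine h.congr fun x hx => ?_
  have h0 : 0 ≤ ⌊(2 : ℝ) ^ N * x⌋ := Int.floor_nonneg.2 (mul_nonneg (by positivity) hx.1)
  obtain ⟨k, hk⟩ := Int.eq_ofNat_of_zero_le h0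
  have hk1 : (k : ℝ) ≤ 2 ^ N * x := by
    have := Int.floor_le ((2 : ℝ) ^ N * x); rw [hk] at this; exact_mod_cast this
  have hk2 : 2 ^ N * x < k + 1 := by
    have := Int.lt_floor_add_one ((2 : ℝ) ^ N * x); rw [hk] at this; exact_mod_cast this
  have hkN : k < 2 ^ N := by
    have : (k : ℝ) < 2 ^ N := hk1.trans_lt (mul_lt_of_lt_one_right (by positivity) hx.2)
    exact_mod_cast this
  dsimp only
  rw [Finset.sum_eq_single k]
  · have hf : Int.fract (2 ^ N * x) = 2 ^ N * x - k := by rw [Int.fract, hk]; simp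
    rw [max_eq_right (by rw [← hf]; exact tent_fract_nonneg _), hf, hk]
  · intro j _ hj
    rw [max_eq_left, zero_mul]
    rcases lt_or_gt_of_ne hj with hj | hj
    · have : (j : ℝ) + 1 ≤ k := by exact_mod_cast hj
      exact (min_le_right _ _).trans (by linarith)
    · have : (k : ℝ) + 1 ≤ j := by exact_mod_cast hj
      exact (min_le_left _ _).trans (by linarith)
  · intro h
    exact absurd (Finset.mem_range.2 hkN) h

end TentFunctions

section BrownianMotion

/-- The `n`-th term of the Lévy–Ciesielski expansion of the Brownian bridge. -/
noncomputable def levyTerm (ξ : ℕ × ℤ → ℝ) (n : ℕ) (x : ℝ) : ℝ :=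
  √(1 / 2) ^ n * (tent (Int.fract (2 ^ n * x)) * ξ (n, ⌊(2 : ℝ) ^ n * x⌋))

/-- The time change `s ↦ s / (1 + s)` from the half-line to the unit interval. -/
noncomputable def bridgeTime (s : ℝ) : ℝ := max s 0 / (1 + max s 0)

/-- The path of Brownian motion obtained from the Lévy–Ciesielski coefficients `ξ` by time-changing
and rescaling the Brownian bridge. -/
noncomputable def brownianPath (ξ : ℕ × ℤ → ℝ) (s : ℝ) : ℝ :=
  (1 + max s 0) * ∑' n, levyTerm ξ n (bridgeTime s)

lemma bridgeTime_mem (s : ℝ) : bridgeTime s ∈ Ico (0 : ℝ) 1 := by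
  have h : 0 ≤ max s 0 := le_max_right _ _
  exact ⟨by unfold bridgeTime; positivity, (div_lt_one (by positivity)).2 (by linarith)⟩

lemma continuous_bridgeTime : Continuous bridgeTime := by
  unfold bridgeTime
  refine Continuous.div (by fun_prop) (by fun_prop) fun s => ?_
  have h : 0 ≤ max s 0 := le_max_right _ _
  positivity

lemma mul_mul_bridge_bridgeTime {s t : ℝ} (hs : 0 ≤ s) (ht : 0 ≤ t) :
    (1 + max s 0) * (1 + max t 0) * bridge (bridgeTime s) (bridgeTime t) = min s t := by
  rw [bridgeTime, bridgeTime, max_eq_left hs, max_eq_left ht]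
  wlog hst : s ≤ t generalizing s t
  · rw [mul_comm (1 + s), bridge_comm, this ht hs (le_of_not_ge hst), min_comm]
  have h1 : s / (1 + s) ≤ t / (1 + t) :=
    (div_le_div_iff₀ (by positivity) (by positivity)).2 (by nlinarith)
  rw [bridge_of_le h1, min_eq_left hst]
  field_simp
  ring

lemma exists_summable_bound_levyTerm {ξ : ℕ × ℤ → ℝ} {S : ℝ}
    (hS : ∀ n : ℕ, ∀ k ∈ Finset.range (2 ^ n), (1 / 4) ^ n * ξ (n, (k : ℤ)) ^ 8 ≤ S) :
    ∃ u : ℕ → ℝ, Summable u ∧ ∀ n, ∀ x ∈ Ico (0 : ℝ) 1, ‖levyTerm ξ n x‖ ≤ u n := by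
  set r : ℝ := √√(1 / 2) with hr
  have hr4 : r ^ 4 = 1 / 2 := by
    rw [show r ^ 4 = (r ^ 2) ^ 2 by ring, hr, Real.sq_sqrt (by positivity),
      Real.sq_sqrt (by positivity)]
  have hr0 : 0 ≤ r := by positivity
  have hr1 : r < 1 := lt_of_pow_lt_pow_left₀ 4 zero_le_one (by rw [hr4]; norm_num)
  have hS0 : 0 ≤ S := le_trans (by positivity) (hS 0 0 (by simp))
  refine ⟨fun n => (1 + S) * r ^ n, (summable_geometric_of_lt_one hr0 hr1).mul_left _,
    fun n x hx => ?_⟩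
  obtain ⟨k, hk⟩ := Int.eq_ofNat_of_zero_le
    (Int.floor_nonneg.2 (mul_nonneg (by positivity) hx.1) : 0 ≤ ⌊(2 : ℝ) ^ n * x⌋)
  have hkn : k < 2 ^ n := by
    have h1 := Int.floor_le ((2 : ℝ) ^ n * x)
    rw [hk] at h1
    have h2 : (k : ℝ) < 2 ^ n :=
      (by exact_mod_cast h1 : (k : ℝ) ≤ 2 ^ n * x).trans_lt
        (mul_lt_of_lt_one_right (by positivity) hx.2)
    exact_mod_cast h2
  have hb := hS n k (Finset.mem_range.2 hkn)
  refine le_of_pow_le_pow_left₀ (n := 8) (by norm_num) (by positivity) ?_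
  have hs8 : (√(1 / 2) ^ n) ^ 8 = ((1 / 4 : ℝ) ^ n) * (1 / 4) ^ n := by
    rw [← pow_mul, mul_comm n, pow_mul, ← mul_pow,
      show √(1 / 2) ^ 8 = ((√(1 / 2)) ^ 2) ^ 4 by ring, Real.sq_sqrt (by positivity)]
    norm_num
  have hr8 : (r ^ n) ^ 8 = (1 / 4) ^ n := by
    rw [← pow_mul, mul_comm n, pow_mul, show r ^ 8 = (r ^ 4) ^ 2 by ring, hr4]
    norm_num
  calc ‖levyTerm ξ n x‖ ^ 8
      = (√(1 / 2) ^ n) ^ 8 * (tent (Int.fract (2 ^ n * x)) ^ 8 * ξ (n, (k : ℤ)) ^ 8) := by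
        rw [levyTerm, hk, Real.norm_eq_abs, Even.pow_abs (by decide), mul_pow, mul_pow]
    _ ≤ (√(1 / 2) ^ n) ^ 8 * (1 * ξ (n, (k : ℤ)) ^ 8) := by
        gcongr
        exact pow_le_one₀ (tent_fract_nonneg _) (tent_fract_le_one _)
    _ = (1 / 4) ^ n * ((1 / 4) ^ n * ξ (n, (k : ℤ)) ^ 8) := by rw [hs8]; ring
    _ ≤ (1 / 4) ^ n * (1 + S) ^ 8 := by
        gcongr
        calc _ ≤ S := hb
          _ ≤ 1 + S := by linarith
          _ ≤ (1 + S) ^ 8 := le_self_pow₀ (by linarith) (by norm_num)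
    _ = ((1 + S) * r ^ n) ^ 8 := by rw [mul_pow, hr8]; ring

lemma continuous_brownianPath {ξ : ℕ × ℤ → ℝ} {u : ℕ → ℝ} (hu : Summable u)
    (h : ∀ n, ∀ x ∈ Ico (0 : ℝ) 1, ‖levyTerm ξ n x‖ ≤ u n) : Continuous (brownianPath ξ) := by
  have h1 : ContinuousOn (fun x => ∑' n, levyTerm ξ n x) (Ico 0 1) := by
    refine continuousOn_tsum (fun n => ?_) hu h
    exact (continuousOn_tent_fract_mul n fun k => ξ (n, k)).const_mul (√(1 / 2) ^ n)
  unfold brownianPath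
  exact (by fun_prop : Continuous fun s : ℝ => 1 + max s 0).mul
    (h1.comp_continuous continuous_bridgeTime bridgeTime_mem)

lemma brownianPath_zero (ξ : ℕ × ℤ → ℝ) : brownianPath ξ 0 = 0 := by
  simp [brownianPath, levyTerm, bridgeTime, tent]

variable {Ω : Type*} [MeasurableSpace Ω] {P : Measure Ω}

lemma isGaussianProcess_sum_mul {S T ι : Type*} [IsProbabilityMeasure P] {X : T → Ω → ℝ}
    (hX : IsGaussianProcess X P) (I : Finset ι) (c : S → ι → ℝ) (t : S → ι → T) :
    IsGaussianProcess (fun s ω => ∑ i ∈ I, c s i * X (t s i) ω) P := by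
  refine isGaussianProcess_of_linearCombinations
    (fun s => (hasGaussianLaw_sum_mul hX I (c s) (t s)).aemeasurable) fun n d s => ?_
  have h := hasGaussianLaw_sum_mul hX (Finset.univ ×ˢ I) (fun p => d p.1 * c (s p.1) p.2)
    (fun p => t (s p.1) p.2)
  have h2 : (fun ω => ∑ i, d i * ∑ j ∈ I, c (s i) j * X (t (s i) j) ω) =
      fun ω => ∑ p ∈ Finset.univ ×ˢ I, d p.1 * c (s p.1) p.2 * X (t (s p.1) p.2) ω := by
    ext ω
    rw [Finset.sum_product]
    simp_rw [Finset.mul_sum, mul_assoc]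
  rw [h2]
  exact ⟨_, _, h.map_eq_gaussianReal⟩

lemma isGaussianProcess_of_iIndepFun {ι : Type*} {ξ : ι → Ω → ℝ} (hξ : iIndepFun ξ P)
    (hg : ∀ i, HasGaussianLaw (ξ i) P) : IsGaussianProcess ξ P :=
  ⟨fun I => iIndepFun.hasGaussianLaw (X := fun i : I => ξ i) (fun i => hg i)
    (hξ.precomp Subtype.val_injective)⟩

lemma ae_exists_bound_coefficients [IsProbabilityMeasure P] {ξ : ℕ × ℤ → Ω → ℝ}
    (hξ : ∀ i, HasLaw (ξ i) (gaussianReal 0 1) P) :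
    ∀ᵐ ω ∂P, ∃ S : ℝ, ∀ n : ℕ, ∀ k ∈ Finset.range (2 ^ n),
      (1 / 4) ^ n * ξ (n, (k : ℤ)) ω ^ 8 ≤ S := by
  have hmeas : ∀ i, AEMeasurable (ξ i) P := fun i => (hξ i).aemeasurable
  set M : ENNReal := ∫⁻ x, ENNReal.ofReal (x ^ 8) ∂(gaussianReal 0 1) with hM
  have hMtop : M ≠ ⊤ := by
    have h : MemLp id 8 (gaussianReal 0 1) := memLp_id_gaussianReal 8
    have h2 : Integrable (fun x : ℝ => x ^ 8) (gaussianReal 0 1) := by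
      have := h.integrable_norm_pow (p := 8) (by norm_num)
      simpa [Even.pow_abs (by decide : Even 8)] using this
    exact h2.lintegral_lt_top.ne
  have hterm : ∀ n k, ∫⁻ ω, ENNReal.ofReal ((1 / 4) ^ n * ξ (n, k) ω ^ 8) ∂P =
      ENNReal.ofReal ((1 / 4) ^ n) * M := by
    intro n k
    simp_rw [ENNReal.ofReal_mul (by positivity : (0 : ℝ) ≤ (1 / 4) ^ n)]
    rw [lintegral_const_mul' _ _ ENNReal.ofReal_ne_top, hM, ← (hξ (n, k)).map_eq,
      lintegral_map' (by fun_prop) (hmeas _)]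
  have hfin : ∫⁻ ω, ∑' n : ℕ, ∑ k ∈ Finset.range (2 ^ n),
      ENNReal.ofReal ((1 / 4) ^ n * ξ (n, (k : ℤ)) ω ^ 8) ∂P ≠ ⊤ := by
    rw [lintegral_tsum fun n => Finset.aemeasurable_fun_sum _ fun k _ => by
      have := hmeas (n, (k : ℤ)); fun_prop]
    have h1 : ∀ n : ℕ, ∫⁻ ω, ∑ k ∈ Finset.range (2 ^ n),
        ENNReal.ofReal ((1 / 4) ^ n * ξ (n, (k : ℤ)) ω ^ 8) ∂P = ENNReal.ofReal ((1 / 2) ^ n) * M := by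
      intro n
      rw [lintegral_finsetSum' _ fun k _ => by have := hmeas (n, (k : ℤ)); fun_prop]
      simp_rw [hterm]
      rw [Finset.sum_const, Finset.card_range, nsmul_eq_mul, ← mul_assoc]
      congr 1
      rw [← ENNReal.ofReal_natCast, ← ENNReal.ofReal_mul (by positivity)]
      push_cast
      rw [← mul_pow]
      norm_num
    simp_rw [h1]
    rw [ENNReal.tsum_mul_right, ← ENNReal.ofReal_tsum_of_nonneg (fun n => by positivity)
      summable_geometric_two]
    exact ENNReal.mul_ne_top ENNReal.ofReal_ne_top hMtop
  have hae := ae_lt_top' (AEMeasurable.tsum fun n =>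
    Finset.aemeasurable_fun_sum _ fun k _ => by
      have := hmeas (n, (k : ℤ)); fun_prop) hfin
  filter_upwards [hae] with ω hω
  refine ⟨_, fun n k hk => (ENNReal.ofReal_le_iff_le_toReal hω.ne).1 ?_⟩
  exact (Finset.single_le_sum (f := fun k : ℕ =>
    ENNReal.ofReal ((1 / 4) ^ n * ξ (n, (k : ℤ)) ω ^ 8)) (fun _ _ => zero_le) hk).trans
    (ENNReal.le_tsum n)

/-- Existence of Brownian motion, by the Lévy–Ciesielski construction. -/
lemma exists_brownianMotion :
    ∃ (Ω : Type) (_ : MeasurableSpace Ω) (P : Measure Ω) (B : ℝ → Ω → ℝ),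
      IsProbabilityMeasure P ∧ (∀ᵐ ω ∂P, Continuous fun s => B s ω) ∧ (∀ ω, B 0 ω = 0) ∧
      IsGaussianProcess B P ∧ (∀ s, ∫ ω, B s ω ∂P = 0) ∧
      ∀ s t, 0 ≤ s → 0 ≤ t → cov[B s, B t; P] = min s t := by
  obtain ⟨Ω, mΩ, P, ξ, hm, hlaw, hind, hP⟩ := exists_iid (ℕ × ℤ) (gaussianReal 0 1)
  have hG : ∀ i, HasGaussianLaw (ξ i) P := fun i => (hlaw i).hasGaussianLaw
  have hξ := isGaussianProcess_of_iIndepFun hind hG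
  have hmean : ∀ i, ∫ ω, ξ i ω ∂P = 0 := fun i => by
    rw [(hlaw i).integral_eq]; simp
  have hcov : ∀ i j, cov[ξ i, ξ j; P] = if i = j then 1 else 0 := by
    intro i j
    split_ifs with h
    · subst h
      rw [covariance_self (hm i).aemeasurable, (hlaw i).variance_eq]; simp
    · exact (hind.indepFun h).covariance_eq_zero (hG i).memLp_two (hG j).memLp_two
  let c : ℝ → ℕ → ℝ := fun s n =>
    (1 + max s 0) * (√(1 / 2) ^ n * tent (Int.fract (2 ^ n * bridgeTime s)))
  let k : ℝ → ℕ → ℕ × ℤ := fun s n => (n, ⌊(2 : ℝ) ^ n * bridgeTime s⌋)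
  have hae : ∀ᵐ ω ∂P, ∃ u : ℕ → ℝ, Summable u ∧
      ∀ n, ∀ x ∈ Ico (0 : ℝ) 1, ‖levyTerm (ξ · ω) n x‖ ≤ u n := by
    filter_upwards [ae_exists_bound_coefficients hlaw] with ω ⟨S, hS⟩
    exact exists_summable_bound_levyTerm hS
  have hlim := isGaussianProcess_of_tendsto
    (X := fun N s ω => ∑ n ∈ Finset.range N, c s n * ξ (k s n) ω)
    (Y := fun s ω => brownianPath (ξ · ω) s)
    (K := fun s t => (1 + max s 0) * (1 + max t 0) * bridge (bridgeTime s) (bridgeTime t)) (P := P)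
    (fun N => isGaussianProcess_sum_mul hξ _ c k)
    (fun N s => by simp [integral_sum_mul hξ, hmean]) (fun s t => ?_) fun s => ?_
  · refine ⟨Ω, mΩ, P, fun s ω => brownianPath (ξ · ω) s, hP, ?_, fun ω => brownianPath_zero _,
      hlim.1, hlim.2.1, fun s t hs ht => ?_⟩
    · filter_upwards [hae] with ω ⟨u, hu, h⟩
      exact continuous_brownianPath hu h
    · rw [hlim.2.2, mul_mul_bridge_bridgeTime hs ht]
  · refine ((tendsto_sum_tent_mul_tent (bridgeTime_mem s) (bridgeTime_mem t)).const_mul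
      ((1 + max s 0) * (1 + max t 0))).congr fun N => ?_
    rw [covariance_sum_mul_sum_mul hξ, Finset.mul_sum]
    refine Finset.sum_congr rfl fun n hn => ?_
    rw [Finset.sum_eq_single n]
    · have hsq : √(1 / 2) ^ n * √(1 / 2) ^ n = (1 / 2 : ℝ) ^ n := by
        rw [← mul_pow, Real.mul_self_sqrt (by positivity)]
      simp only [hcov, k, c, Prod.mk.injEq, true_and]
      split_ifs
      · rw [← hsq]; ring
      · ring
    · intro m _ hmn
      rw [hcov, if_neg, mul_zero]
      intro h
      exact hmn (congrArg Prod.fst h).symm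
    · exact fun h => absurd hn h
  · filter_upwards [hae] with ω ⟨u, hu, h⟩
    have h1 := (Summable.of_norm_bounded hu fun n =>
      h n _ (bridgeTime_mem s)).hasSum.tendsto_sum_nat.const_mul (1 + max s 0)
    refine h1.congr fun N => ?_
    rw [Finset.mul_sum]
    refine Finset.sum_congr rfl fun n _ => ?_
    simp only [levyTerm, c, k]
    ring

end BrownianMotion

lemma isGaussianProcess_const_add {Ω T : Type*} [MeasurableSpace Ω] {P : Measure Ω}
    {X : T → Ω → ℝ} (hX : IsGaussianProcess X P) (m : T → ℝ) :
    IsGaussianProcess (fun t ω => m t + X t ω) P := by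
  have := hX.isProbabilityMeasure
  refine isGaussianProcess_of_linearCombinations (fun t => (hX.aemeasurable t).const_add _)
    fun n c t => ?_
  have h := hasGaussianLaw_sum_mul hX Finset.univ c t
  have h1 := gaussianReal_const_add ⟨h.aemeasurable, h.map_eq_gaussianReal⟩ (∑ i, c i * m (t i))
  refine ⟨_, _, Eq.trans ?_ h1.map_eq⟩
  simp only [mul_add, Finset.sum_add_distrib]

lemma covariance_mul_variance_eq_of_markov {Ω : Type*} [mΩ : MeasurableSpace Ω]
    [StandardBorelSpace Ω] {P : Measure Ω} [IsFiniteMeasure P] {Z : ℝ → Ω → ℝ}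
    (hZ : ∀ t, Measurable (Z t)) {a b s t u : ℝ} (has : a ≤ s) (hst : s ≤ t) (htu : t ≤ u)
    (hub : u ≤ b) (hst' : HasGaussianLaw (fun ω => (Z s ω, Z t ω)) P)
    (hut' : HasGaussianLaw (fun ω => (Z u ω, Z t ω)) P) (hv : Var[Z t; P] ≠ 0)
    (hmarkov : CondIndep (MeasurableSpace.comap (Z t) Real.measurableSpace)
      (⨆ s ∈ Icc a t, MeasurableSpace.comap (Z s) Real.measurableSpace)
      (⨆ u ∈ Icc t b, MeasurableSpace.comap (Z u) Real.measurableSpace)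
      (measurable_iff_comap_le.mp (hZ t)) P) :
    cov[Z s, Z u; P] * Var[Z t; P] = cov[Z s, Z t; P] * cov[Z t, Z u; P] := by
  refine covariance_mul_variance_eq_of_condIndepFun (hZ s) (hZ t) (hZ u) hst' hut' hv ?_
  have h1 : MeasurableSpace.comap (Z s) Real.measurableSpace ≤
      ⨆ s ∈ Icc a t, MeasurableSpace.comap (Z s) Real.measurableSpace :=
    le_iSup₂ (f := fun s (_ : s ∈ Icc a t) => MeasurableSpace.comap (Z s) Real.measurableSpace)
      s ⟨has, hst⟩
  have h2 : MeasurableSpace.comap (Z u) Real.measurableSpace ≤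
      ⨆ u ∈ Icc t b, MeasurableSpace.comap (Z u) Real.measurableSpace :=
    le_iSup₂ (f := fun u (_ : u ∈ Icc t b) => MeasurableSpace.comap (Z u) Real.measurableSpace)
      u ⟨htu, hub⟩
  exact condIndep_of_condIndep_of_le_right (condIndep_of_condIndep_of_le_left hmarkov h1) h2

end GaussianMarkov

/-- Lemma 4 of the paper: a continuous, non-degenerate Gaussian Markov process
`Z = (Z_t)_{t ∈ [a,b]}` has the same finite-dimensional distributions as
`(m(t) + u(t)·B̂_{v(t)})_{t ∈ [a,b]}` for continuous functions `m, u, v` with `u, v > 0`,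
`v` non-decreasing, and `B̂` a standard Brownian motion. -/
theorem gaussian_markov_representation
    {Ω : Type*} [mΩ : MeasurableSpace Ω] [StandardBorelSpace Ω]
    (P : Measure Ω) [IsProbabilityMeasure P]
    (a b : ℝ) (hab : a ≤ b)
    (Z : ℝ → Ω → ℝ) (hZmeas : ∀ t, Measurable (Z t))
    -- a.s. continuous paths on `[a,b]`
    (hcont : ∀ᵐ ω ∂P, ContinuousOn (fun t => Z t ω) (Set.Icc a b))
    -- Gaussian process: every finite linear combination of coordinates is Gaussian
    (hgauss : ∀ (n : ℕ) (c : Fin n → ℝ) (t : Fin n → ℝ), (∀ i, t i ∈ Set.Icc a b) →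
      ∃ (μ : ℝ) (v : ℝ≥0), P.map (fun ω => ∑ i, c i * Z (t i) ω) = gaussianReal μ v)
    -- non-degeneracy: `Var(Z_t) > 0` and `|Corr(Z_s, Z_t)| < 1` for `s ≠ t`
    (hvar : ∀ t ∈ Set.Icc a b, 0 < cov P (Z t) (Z t))
    (hcorr : ∀ s ∈ Set.Icc a b, ∀ t ∈ Set.Icc a b, s ≠ t →
      |cov P (Z s) (Z t)| < Real.sqrt (cov P (Z s) (Z s) * cov P (Z t) (Z t)))
    -- Markov property: past and future are conditionally independent given the present
    (hmarkov : ∀ t ∈ Set.Icc a b,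
      CondIndep (MeasurableSpace.comap (Z t) Real.measurableSpace)
        (⨆ s ∈ Set.Icc a t, MeasurableSpace.comap (Z s) Real.measurableSpace)
        (⨆ u ∈ Set.Icc t b, MeasurableSpace.comap (Z u) Real.measurableSpace)
        (measurable_iff_comap_le.mp (hZmeas t)) P) :
    ∃ m u v : ℝ → ℝ,
      ContinuousOn m (Set.Icc a b) ∧ ContinuousOn u (Set.Icc a b) ∧
      ContinuousOn v (Set.Icc a b) ∧
      (∀ t ∈ Set.Icc a b, 0 < u t) ∧ (∀ t ∈ Set.Icc a b, 0 < v t) ∧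
      MonotoneOn v (Set.Icc a b) ∧
      ∃ (Ω' : Type) (mΩ' : MeasurableSpace Ω') (P' : Measure Ω') (B : ℝ → Ω' → ℝ),
        IsProbabilityMeasure P' ∧ IsStandardBrownianMotion P' B ∧
        ∀ (n : ℕ) (t : Fin n → ℝ), (∀ i, t i ∈ Set.Icc a b) →
          P.map (fun ω i => Z (t i) ω)
            = P'.map (fun ω i => m (t i) + u (t i) * B (v (t i)) ω) := by
  have hZc : ∀ X Y, cov P X Y = cov[X, Y; P] := fun _ _ => rfl
  have hXG : IsGaussianProcess (fun (t : Icc a b) => Z t) P :=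
    GaussianMarkov.isGaussianProcess_of_linearCombinations (fun t => (hZmeas t).aemeasurable)
      fun n c t => hgauss n c (fun i => t i) fun i => (t i).2
  have hXc : ∀ᵐ ω ∂P, Continuous fun t : Icc a b => Z t ω := by
    filter_upwards [hcont] with ω hω
    exact continuousOn_iff_continuous_domRestrict.1 hω
  have hself : ∀ t, cov[Z t, Z t; P] = Var[Z t; P] := fun t =>
    covariance_self (hZmeas t).aemeasurable
  have hpair : ∀ s ∈ Icc a b, ∀ t ∈ Icc a b, HasGaussianLaw (fun ω => (Z s ω, Z t ω)) P :=
    fun s hs t ht => hXG.hasGaussianLaw_prodMk (s := ⟨s, hs⟩) (t := ⟨t, ht⟩)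
  have hmem : ∀ t ∈ Icc a b, MemLp (Z t) 2 P := fun t ht =>
    GaussianMarkov.memLp_two hXG ⟨t, ht⟩
  obtain ⟨u, v, hu, hv, hu0, hv0, hvm, hR⟩ :=
    GaussianMarkov.exists_eq_mul_mul_of_factorization (R := fun s t => cov[Z s, Z t; P]) hab
      (fun r hr => continuousOn_iff_continuous_domRestrict.2
        (GaussianMarkov.continuous_covariance_of_ae_continuous hXG hXc ⟨r, hr⟩))
      (by
        simp only [hself]
        exact continuousOn_iff_continuous_domRestrict.2
          (GaussianMarkov.continuous_variance_of_ae_continuous hXG hXc))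
      (fun s t => covariance_comm _ _) hvar
      (fun s hs t ht => by
        simp only [hself]
        exact GaussianMarkov.covariance_sq_le (hmem s hs) (hmem t ht))
      (fun s t u has hst htu hub => by
        have hs : s ∈ Icc a b := ⟨has, hst.trans (htu.trans hub)⟩
        have ht : t ∈ Icc a b := ⟨has.trans hst, htu.trans hub⟩
        have hu : u ∈ Icc a b := ⟨has.trans (hst.trans htu), hub⟩
        simp only [hself]
        refine GaussianMarkov.covariance_mul_variance_eq_of_markov hZmeas has hst htu hub
          (hpair s hs t ht) (hpair u hu t ht) ?_ (hmarkov t ht)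
        rw [← hself]
        exact (hvar t ht).ne')
  obtain ⟨Ω', mΩ', P', B, hP', hBc, hB0, hBG, hBm, hBv⟩ := GaussianMarkov.exists_brownianMotion
  refine ⟨fun t => ∫ ω, Z t ω ∂P, u, v, continuousOn_iff_continuous_domRestrict.2
    (GaussianMarkov.continuous_integral_of_ae_continuous hXG hXc), hu, hv, hu0, hv0, hvm,
    Ω', mΩ', P', B, hP', ⟨hBc, ae_of_all _ hB0, fun n c t _ => ?_, fun s _ => hBm s,
      fun s t hs ht => ?_⟩, fun n t ht => ?_⟩
  · exact ⟨_, _, (GaussianMarkov.hasGaussianLaw_sum_mul hBG Finset.univ c t).map_eq_gaussianReal⟩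
  · rw [← hBv s t hs ht, covariance_eq_sub (GaussianMarkov.memLp_two hBG s)
      (GaussianMarkov.memLp_two hBG t), hBm, hBm]
    simp
  · have hYG : IsGaussianProcess (fun (t : Icc a b) ω => u t * B (v t) ω) P' :=
      (hBG.comp_right fun t : Icc a b => v t).smul fun t : Icc a b => u t
    have hBi : ∀ s, Integrable (B s) P' := fun s => (hBG.hasGaussianLaw_eval s).integrable
    refine GaussianMarkov.map_eq_of_mean_eq_of_covariance_eq hXG
      (GaussianMarkov.isGaussianProcess_const_add hYG fun t => ∫ ω, Z t ω ∂P) (fun t => ?_)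
      (fun s t => ?_) (fun i => (⟨t i, ht i⟩ : Icc a b))
    · rw [integral_add (integrable_const _) ((hBi _).const_mul _), integral_const_mul, hBm]
      simp
    · rw [covariance_const_add_left ((hBi _).const_mul _),
        covariance_const_add_right ((hBi _).const_mul _), covariance_const_mul_left,
        covariance_const_mul_right, hBv _ _ (hv0 _ s.2).le (hv0 _ t.2).le, ← mul_assoc]
      exact hR s s.2 t t.2
end

section
/- Let B be a standard Brownian motion, let h, σ : [0,1) → ℝ be continuous with σ > 0, define φ(t) := exp(−∫₀ᵗ h(r) dr) and w(t) := ∫₀ᵗ σ(r)²/φ(r)² dr. Fix x, y ∈ ℝ with x ≠ y and set X_t := φ(t)·x + (1−φ(t))·y + φ(t)·B_{w(t)}. If X_t converges in probability to y as t → 1⁻, then lim_{t→1⁻} φ(t) = 0, equivalently ∫₀ᵗ h(r) dr → +∞ as t → 1⁻. (Remark 3 of the paper: the divergence of ∫₀ᵗ h dr in assumption (A1) is necessary for the diffusion to be pinned.) -/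
open MeasureTheory ProbabilityTheory Filter Topology Set
open scoped NNReal ENNReal

/-- A centered real Gaussian law gives mass at least `1/2` to the nonnegative half-line. -/
theorem half_le_gaussianReal_zero_Ici (v : ℝ≥0) : 2⁻¹ ≤ gaussianReal 0 v (Ici 0) := by
  have hsymm : gaussianReal 0 v (Iic 0) = gaussianReal 0 v (Ici 0) := by
    have hneg := gaussianReal_map_neg (μ := 0) (v := v)
    rw [neg_zero] at hneg
    conv_rhs => rw [← hneg, Measure.map_apply measurable_neg measurableSet_Ici]
    congr 1
    ext a
    simp
  have hone : 1 ≤ gaussianReal 0 v (Ici 0) + gaussianReal 0 v (Ici 0) := calc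
    1 = gaussianReal 0 v (Iic 0 ∪ Ici 0) := by rw [Iic_union_Ici, measure_univ]
    _ ≤ gaussianReal 0 v (Iic 0) + gaussianReal 0 v (Ici 0) := measure_union_le _ _
    _ = _ := by rw [hsymm]
  rw [← two_mul, mul_comm] at hone
  rw [← one_div]
  exact ENNReal.div_le_of_le_mul hone

/-- A multiple of a Brownian motion at a fixed time is nonnegative with probability at least
`1/2`. -/
theorem IsStandardBrownianMotion.half_le_measure_mul_nonneg {Ω : Type*} [MeasurableSpace Ω]
    {P : Measure Ω} {B : ℝ → Ω → ℝ} (hB : IsStandardBrownianMotion P B) (c : ℝ) {s : ℝ}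
    (hs : 0 ≤ s) : 2⁻¹ ≤ P {ω | 0 ≤ c * B s ω} := by
  obtain ⟨-, -, hgauss, hmean, -⟩ := hB
  obtain ⟨m, v, hlaw⟩ := hgauss 1 (fun _ => c) (fun _ => s) fun _ => hs
  simp only [Finset.univ_unique, Finset.sum_singleton] at hlaw
  have hmeas : AEMeasurable (fun ω => c * B s ω) P :=
    AEMeasurable.of_map_ne_zero (hlaw ▸ IsProbabilityMeasure.ne_zero _)
  have hm : m = 0 := calc
    m = ∫ a, a ∂(P.map fun ω => c * B s ω) := by rw [hlaw, integral_id_gaussianReal]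
    _ = ∫ ω, c * B s ω ∂P := integral_map hmeas aestronglyMeasurable_id
    _ = 0 := by rw [integral_const_mul, hmean s hs, mul_zero]
  subst hm
  calc 2⁻¹ ≤ gaussianReal 0 v (Ici 0) := half_le_gaussianReal_zero_Ici v
    _ = P {ω | 0 ≤ c * B s ω} := by
      rw [← hlaw, Measure.map_apply_of_aemeasurable hmeas measurableSet_Ici]
      rfl

/-- Remark 3 of the paper: the divergence of `∫₀ᵗ h` in assumption (A1) is necessary for
pinning. If `X_t = φ(t)x + (1−φ(t))y + φ(t)B_{w(t)}` with `x ≠ y` converges in probability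
to `y` as `t → 1⁻`, then `φ(t) → 0`, equivalently `∫₀ᵗ h → +∞`. -/
theorem divergence_necessary_for_pinning
    {Ω : Type*} [MeasurableSpace Ω] (P : Measure Ω) [IsProbabilityMeasure P]
    (B : ℝ → Ω → ℝ) (hB : IsStandardBrownianMotion P B)
    (h σ : ℝ → ℝ)
    (hh : ContinuousOn h (Set.Ico 0 1)) (hσ : ContinuousOn σ (Set.Ico 0 1))
    (hσpos : ∀ t ∈ Set.Ico (0:ℝ) 1, 0 < σ t)
    (φ w : ℝ → ℝ)
    (hφ : ∀ t ∈ Set.Ico (0:ℝ) 1, φ t = Real.exp (-∫ r in (0:ℝ)..t, h r))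
    (hw : ∀ t ∈ Set.Ico (0:ℝ) 1, w t = ∫ r in (0:ℝ)..t, (σ r) ^ 2 / (φ r) ^ 2)
    (x y : ℝ) (hxy : x ≠ y)
    -- `X_t → y` in probability as `t → 1⁻`
    (hconv : ∀ ε : ℝ, 0 < ε →
      Tendsto (fun t => P {ω | ε < |φ t * x + (1 - φ t) * y + φ t * B (w t) ω - y|})
        (𝓝[<] 1) (𝓝 0)) :
    Tendsto φ (𝓝[<] 1) (𝓝 0) ∧
    Tendsto (fun t => ∫ r in (0:ℝ)..t, h r) (𝓝[<] 1) atTop := by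
  have hIco : ∀ᶠ t in 𝓝[<] (1 : ℝ), t ∈ Ico (0 : ℝ) 1 := Ico_mem_nhdsLT one_pos
  have hφpos : ∀ t ∈ Ico (0 : ℝ) 1, 0 < φ t := fun t ht => hφ t ht ▸ Real.exp_pos _
  have hd : 0 < |x - y| := abs_pos.2 (sub_ne_zero.2 hxy)
  have hφlim : Tendsto φ (𝓝[<] 1) (𝓝 0) := by
    refine tendsto_order.2 ⟨fun a ha => ?_, fun δ hδ => ?_⟩
    · filter_upwards [hIco] with t ht using ha.trans (hφpos t ht)
    have hsmall := (hconv (δ / 2 * |x - y|) (by positivity)).eventually_lt_const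
      (show (0 : ℝ≥0∞) < 2⁻¹ by simp)
    filter_upwards [hIco, hsmall] with t ht hlt
    by_contra! hge
    have hwt : 0 ≤ w t := by
      rw [hw t ht]
      exact intervalIntegral.integral_nonneg ht.1 fun r _ => by positivity
    refine hlt.not_ge ((hB.half_le_measure_mul_nonneg (x - y) hwt).trans (measure_mono ?_))
    intro ω hω
    have hω' : 0 ≤ (x - y) * B (w t) ω := hω
    have habs : |x - y| ≤ |x - y + B (w t) ω| :=
      sq_le_sq.1 (by nlinarith [sq_nonneg (B (w t) ω)])
    calc δ / 2 * |x - y| < φ t * |x - y| := by gcongr; linarith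
      _ ≤ φ t * |x - y + B (w t) ω| := by gcongr; exact (hφpos t ht).le
      _ = |φ t * x + (1 - φ t) * y + φ t * B (w t) ω - y| := by
        rw [← abs_of_pos (hφpos t ht), ← abs_mul, abs_of_pos (hφpos t ht)]
        ring_nf
  refine ⟨hφlim, ?_⟩
  have hφlim' : Tendsto φ (𝓝[<] 1) (𝓝[>] 0) :=
    tendsto_nhdsWithin_iff.2 ⟨hφlim, hIco.mono hφpos⟩
  refine (tendsto_neg_atBot_atTop.comp (Real.tendsto_log_nhdsGT_zero.comp hφlim')).congr' ?_
  filter_upwards [hIco] with t ht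
  simp [hφ t ht]
end

section
/- Let h(t) := (2−t)/(1−t)² for t ∈ [0,1). Then for every δ ∈ (0,1), exp( −2δ·∫₀ᵗ h(s) ds ) · ∫₀ᵗ exp( 2·∫₀ʳ h(s) ds ) dr = (1/2)·(1−t)^{2δ}·exp(−2δt/(1−t))·( exp(2t/(1−t)) − 1 ) → +∞ as t → 1⁻. In particular the quantity sup_{t∈[0,1)} exp(−2δ∫₀ᵗ h) ∫₀ᵗ exp(2∫₀ʳ h) σ(r)² dr with σ ≡ 1 is infinite for every δ ∈ (0,1), i.e., condition (A2') of Barczy–Kern fails for this h even though conditions (A1) and (A2) hold. (Remark 4 of the paper, comparing assumption (A2) with the condition (A2') of Barczy and Kern.) -/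
open Filter Topology Set

/-- A primitive of `s ↦ (2 - s) / (1 - s) ^ 2` on `[0, 1)`. -/
theorem integral_two_sub_div_one_sub_sq {t : ℝ} (ht : t ∈ Ico (0 : ℝ) 1) :
    ∫ s in (0:ℝ)..t, (2 - s) / (1 - s) ^ 2 = -Real.log (1 - t) + t / (1 - t) := by
  have hne : ∀ x ∈ uIcc 0 t, 1 - x ≠ 0 := fun x hx => by
    rw [uIcc_of_le ht.1] at hx
    linarith [hx.2, ht.2]
  have hderiv : ∀ x ∈ uIcc 0 t,
      HasDerivAt (fun x : ℝ => -Real.log (1 - x) + x / (1 - x)) ((2 - x) / (1 - x) ^ 2) x := by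
    intro x hx
    have hx0 := hne x hx
    have hsub : HasDerivAt (fun x : ℝ => 1 - x) (-1) x := (hasDerivAt_id x).const_sub 1
    refine ((hsub.log hx0).neg.add ((hasDerivAt_id x).div hsub hx0)).congr_deriv ?_
    simp only [id]
    field_simp
    ring
  have hcont : ContinuousOn (fun x : ℝ => (2 - x) / (1 - x) ^ 2) (uIcc 0 t) :=
    ContinuousOn.div (by fun_prop) (by fun_prop) fun x hx => pow_ne_zero 2 (hne x hx)
  rw [intervalIntegral.integral_eq_sub_of_hasDerivAt hderiv hcont.intervalIntegrable]
  simp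

theorem exp_two_mul_neg_log_add {t : ℝ} (ht : t < 1) :
    Real.exp (2 * (-Real.log (1 - t) + t / (1 - t)))
      = Real.exp (2 * t / (1 - t)) * (1 / (1 - t) ^ 2) := by
  have hpos : 0 < 1 - t := by linarith
  rw [mul_add, Real.exp_add, mul_comm, ← mul_div_assoc, mul_neg, Real.exp_neg,
    mul_comm 2 (Real.log _), Real.exp_mul, Real.exp_log hpos, Real.rpow_two, one_div]

theorem integral_exp_two_mul_integral {t : ℝ} (ht : t ∈ Ico (0 : ℝ) 1) :
    ∫ r in (0:ℝ)..t, Real.exp (2 * ∫ s in (0:ℝ)..r, (2 - s) / (1 - s) ^ 2)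
      = (1 / 2) * (Real.exp (2 * t / (1 - t)) - 1) := by
  have hne : ∀ x ∈ uIcc 0 t, 1 - x ≠ 0 := fun x hx => by
    rw [uIcc_of_le ht.1] at hx
    linarith [hx.2, ht.2]
  have hcongr : EqOn (fun r : ℝ => Real.exp (2 * ∫ s in (0:ℝ)..r, (2 - s) / (1 - s) ^ 2))
      (fun r => Real.exp (2 * r / (1 - r)) * (1 / (1 - r) ^ 2)) (uIcc 0 t) := by
    intro r hr
    rw [uIcc_of_le ht.1] at hr
    have hr1 : r < 1 := hr.2.trans_lt ht.2
    simp only [integral_two_sub_div_one_sub_sq ⟨hr.1, hr1⟩, exp_two_mul_neg_log_add hr1]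
  have hderiv : ∀ x ∈ uIcc 0 t,
      HasDerivAt (fun x : ℝ => (1 / 2) * Real.exp (2 * x / (1 - x)))
        (Real.exp (2 * x / (1 - x)) * (1 / (1 - x) ^ 2)) x := by
    intro x hx
    have hx0 := hne x hx
    have hsub : HasDerivAt (fun x : ℝ => 1 - x) (-1) x := (hasDerivAt_id x).const_sub 1
    have hmul : HasDerivAt (fun x : ℝ => 2 * x) (2 * 1) x := (hasDerivAt_id x).const_mul 2
    refine ((hmul.div hsub hx0).exp.const_mul (1 / 2)).congr_deriv ?_
    simp only [Pi.div_apply]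
    field_simp
    ring
  have hcont : ContinuousOn (fun x : ℝ => Real.exp (2 * x / (1 - x)) * (1 / (1 - x) ^ 2))
      (uIcc 0 t) :=
    (ContinuousOn.div (by fun_prop) (by fun_prop) hne).rexp.mul
      (ContinuousOn.div (by fun_prop) (by fun_prop) fun x hx => pow_ne_zero 2 (hne x hx))
  rw [intervalIntegral.integral_congr hcongr,
    intervalIntegral.integral_eq_sub_of_hasDerivAt hderiv hcont.intervalIntegrable]
  simp
  ring

theorem exp_mul_integral_exp_eq (δ : ℝ) {t : ℝ} (ht : t ∈ Ico (0 : ℝ) 1) :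
    Real.exp (-(2 * δ) * ∫ s in (0:ℝ)..t, (2 - s) / (1 - s) ^ 2)
        * (∫ r in (0:ℝ)..t, Real.exp (2 * ∫ s in (0:ℝ)..r, (2 - s) / (1 - s) ^ 2))
      = (1 / 2) * (1 - t) ^ (2 * δ) * Real.exp (-(2 * δ) * t / (1 - t))
        * (Real.exp (2 * t / (1 - t)) - 1) := by
  have hpos : 0 < 1 - t := by linarith [ht.2]
  rw [integral_exp_two_mul_integral ht, integral_two_sub_div_one_sub_sq ht, mul_add, Real.exp_add,
    Real.rpow_def_of_pos hpos, ← mul_div_assoc,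
    show -(2 * δ) * -Real.log (1 - t) = Real.log (1 - t) * (2 * δ) by ring]
  ring

theorem closed_form_eq_exp_div_rpow (δ : ℝ) {t : ℝ} (ht : t < 1) :
    (1 / 2) * (1 - t) ^ (2 * δ) * Real.exp (-(2 * δ) * t / (1 - t))
        * (Real.exp (2 * t / (1 - t)) - 1)
      = Real.exp (2 * (1 - δ) * (1 - t)⁻¹) / (1 - t)⁻¹ ^ (2 * δ)
        * (Real.exp (-(2 * (1 - δ))) / 2 * (1 - Real.exp (2 - 2 * (1 - t)⁻¹))) := by
  have hpos : 0 < 1 - t := by linarith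
  have hu : t / (1 - t) = (1 - t)⁻¹ - 1 := by field_simp; ring
  rw [Real.inv_rpow hpos.le, div_inv_eq_mul, mul_div_assoc, mul_div_assoc, hu]
  generalize (1 - t)⁻¹ = w
  have h₁ : Real.exp (-(2 * δ) * (w - 1)) * Real.exp (2 * (w - 1))
      = Real.exp (2 * (1 - δ) * w) * Real.exp (-(2 * (1 - δ))) := by
    rw [← Real.exp_add, ← Real.exp_add]; ring_nf
  have h₂ : Real.exp (2 * (w - 1)) * Real.exp (2 - 2 * w) = 1 := by
    rw [← Real.exp_add]; ring_nf; exact Real.exp_zero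
  linear_combination (1 / 2) * (1 - t) ^ (2 * δ) * (1 - Real.exp (2 - 2 * w)) * h₁
    + (1 / 2) * (1 - t) ^ (2 * δ) * Real.exp (-(2 * δ) * (w - 1)) * h₂

theorem tendsto_one_sub_inv_nhdsLT_one :
    Tendsto (fun t : ℝ => (1 - t)⁻¹) (𝓝[<] 1) atTop := by
  refine tendsto_inv_nhdsGT_zero.comp (tendsto_nhdsWithin_iff.2 ⟨?_, ?_⟩)
  · have h : Tendsto (fun t : ℝ => 1 - t) (𝓝 1) (𝓝 (1 - 1)) :=
      (continuous_const.sub continuous_id).tendsto 1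
    rw [sub_self] at h
    exact h.mono_left nhdsWithin_le_nhds
  · filter_upwards [self_mem_nhdsWithin] with t ht
    exact sub_pos.2 (mem_Iio.1 ht)

theorem tendsto_closed_form_atTop {δ : ℝ} (hδ : δ < 1) :
    Tendsto (fun t : ℝ => (1 / 2) * (1 - t) ^ (2 * δ) * Real.exp (-(2 * δ) * t / (1 - t))
      * (Real.exp (2 * t / (1 - t)) - 1)) (𝓝[<] 1) atTop := by
  have hexp : Tendsto (fun w : ℝ => Real.exp (2 - 2 * w)) atTop (𝓝 0) :=
    Real.tendsto_exp_atBot.comp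
      (tendsto_const_nhds.add_atBot (tendsto_neg_atTop_atBot.comp
        (tendsto_id.const_mul_atTop (by norm_num : (0:ℝ) < 2))))
  have hfactor : Tendsto
      (fun w : ℝ => Real.exp (-(2 * (1 - δ))) / 2 * (1 - Real.exp (2 - 2 * w))) atTop
      (𝓝 (Real.exp (-(2 * (1 - δ))) / 2 * (1 - 0))) :=
    (hexp.const_sub 1).const_mul _
  have hlim := ((tendsto_exp_mul_div_rpow_atTop (2 * δ) (2 * (1 - δ)) (by linarith)).atTop_mul_pos
    (by positivity) hfactor).comp tendsto_one_sub_inv_nhdsLT_one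
  refine hlim.congr' ?_
  filter_upwards [self_mem_nhdsWithin] with t ht
  exact (closed_form_eq_exp_div_rpow δ ht).symm

/-- Remark 4 of the paper: for `h(t) = (2−t)/(1−t)²` and any `δ ∈ (0,1)`,
`exp(−2δ∫₀ᵗ h)·∫₀ᵗ exp(2∫₀ʳ h) dr = (1/2)(1−t)^{2δ} exp(−2δt/(1−t))(exp(2t/(1−t)) − 1)`
which tends to `+∞` as `t → 1⁻`; in particular (with `σ ≡ 1`) the supremum over `t ∈ [0,1)`
is infinite, i.e. condition (A2') of Barczy–Kern fails. -/
theorem remark4_A2'_fails (δ : ℝ) (hδ : δ ∈ Set.Ioo (0:ℝ) 1) :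
    (∀ t ∈ Set.Ico (0:ℝ) 1,
      Real.exp (-(2 * δ) * ∫ s in (0:ℝ)..t, (2 - s) / (1 - s) ^ 2)
          * (∫ r in (0:ℝ)..t, Real.exp (2 * ∫ s in (0:ℝ)..r, (2 - s) / (1 - s) ^ 2))
        = (1 / 2) * (1 - t) ^ (2 * δ) * Real.exp (-(2 * δ) * t / (1 - t))
          * (Real.exp (2 * t / (1 - t)) - 1)) ∧
    Tendsto
      (fun t => Real.exp (-(2 * δ) * ∫ s in (0:ℝ)..t, (2 - s) / (1 - s) ^ 2)
        * (∫ r in (0:ℝ)..t, Real.exp (2 * ∫ s in (0:ℝ)..r, (2 - s) / (1 - s) ^ 2)))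
      (𝓝[<] 1) atTop ∧
    ¬ BddAbove
      ((fun t => Real.exp (-(2 * δ) * ∫ s in (0:ℝ)..t, (2 - s) / (1 - s) ^ 2)
          * (∫ r in (0:ℝ)..t,
              Real.exp (2 * ∫ s in (0:ℝ)..r, (2 - s) / (1 - s) ^ 2) * (1:ℝ) ^ 2))
        '' Set.Ico (0:ℝ) 1) := by
  have hmem : ∀ᶠ t in 𝓝[<] (1:ℝ), t ∈ Ico (0:ℝ) 1 := Ico_mem_nhdsLT one_pos
  have hlim : Tendsto
      (fun t => Real.exp (-(2 * δ) * ∫ s in (0:ℝ)..t, (2 - s) / (1 - s) ^ 2)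
        * (∫ r in (0:ℝ)..t, Real.exp (2 * ∫ s in (0:ℝ)..r, (2 - s) / (1 - s) ^ 2)))
      (𝓝[<] 1) atTop :=
    (tendsto_closed_form_atTop hδ.2).congr'
      (hmem.mono fun t ht => (exp_mul_integral_exp_eq δ ht).symm)
  refine ⟨fun t ht => exp_mul_integral_exp_eq δ ht, hlim, ?_⟩
  rintro ⟨M, hM⟩
  simp only [one_pow, mul_one] at hM
  obtain ⟨t, ht, hlt⟩ := (hmem.and (hlim.eventually_gt_atTop M)).exists
  exact (hM (mem_image_of_mem _ ht)).not_gt hlt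
end

section
/- Let α : [0,1] → ℝ be continuous with α(1) > 0, and define h(t) := α(t)/(1−t) for t ∈ [0,1). Then h is bounded from below on [0,1) and ∫₀ᵗ h(r) dr → +∞ as t → 1⁻; that is, condition (A1) holds (and with σ ≡ 1 condition (A2) holds trivially), so the associated α-pinned Brownian diffusions are pinned. Moreover, with σ ≡ 1 one has Σ := lim_{t→1⁻} ∫₀ᵗ σ(r)² dr = 1 and σ(t)²/(Σ − ∫₀ᵗ σ(r)² dr) = 1/(1−t), and h satisfies relation (eq:hFbridge) if and only if α(t) = 1 for all t ∈ [0,1). (Section 4.1 of the paper: the α-pinned Brownian diffusions are pinned, and they arise as bridges of a Gaussian Markov process or regular Itô diffusion only when α ≡ 1.) -/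
open Filter Topology Set

open MeasureTheory intervalIntegral

/-- If `α` is continuous on `[0,1]` and `c < α 1`, then `α t / (1 - t)` dominates
`c / (1 - t)` on `[0,1)` up to an additive constant. -/
lemma exists_sub_le_div_one_sub {α : ℝ → ℝ} (hα : ContinuousOn α (Icc 0 1)) {c : ℝ}
    (hc : c < α 1) :
    ∃ K : ℝ, ∀ t ∈ Ico (0:ℝ) 1, c / (1 - t) - K ≤ α t / (1 - t) := by
  obtain ⟨m, hm⟩ := isCompact_Icc.bddBelow_image hα
  have hev : ∀ᶠ t in 𝓝[Icc 0 1] (1:ℝ), c < α t :=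
    (hα 1 (right_mem_Icc.2 zero_le_one)).eventually_const_lt hc
  obtain ⟨ε, hε, hball⟩ := Metric.mem_nhdsWithin_iff.1 hev
  refine ⟨|c - m| / ε, fun t ht => ?_⟩
  have h1t : 0 < 1 - t := sub_pos.2 ht.2
  have hmt : m ≤ α t := hm ⟨t, Ico_subset_Icc_self ht, rfl⟩
  suffices h : (c - α t) / (1 - t) ≤ |c - m| / ε by
    rw [sub_div] at h
    linarith
  rcases lt_or_ge (1 - t) ε with hlt | hge
  · have hct : c < α t := hball ⟨by
      rw [Metric.mem_ball, dist_comm, Real.dist_eq, abs_of_pos h1t]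
      exact hlt, Ico_subset_Icc_self ht⟩
    exact (div_nonpos_of_nonpos_of_nonneg (by linarith) h1t.le).trans (by positivity)
  · exact div_le_div₀ (abs_nonneg _) (by linarith [le_abs_self (c - m)]) hε hge

lemma continuousOn_div_one_sub {α : ℝ → ℝ} {t : ℝ} (hα : ContinuousOn α (Icc 0 1))
    (ht : t < 1) : ContinuousOn (fun r => α r / (1 - r)) (Icc 0 t) :=
  (hα.mono (Icc_subset_Icc_right ht.le)).div (by fun_prop)
    fun _ hr => (sub_pos.2 (hr.2.trans_lt ht)).ne'

lemma integral_const_div_one_sub {c t : ℝ} (ht₀ : 0 ≤ t) (ht : t < 1) :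
    ∫ r in (0:ℝ)..t, c / (1 - r) = -c * Real.log (1 - t) := by
  have hderiv : ∀ r ∈ uIcc 0 t,
      HasDerivAt (fun r => -c * Real.log (1 - r)) (c / (1 - r)) r := fun r hr => by
    rw [uIcc_of_le ht₀] at hr
    have hr1 : 1 - r ≠ 0 := (sub_pos.2 (hr.2.trans_lt ht)).ne'
    exact ((((hasDerivAt_id' r).const_sub 1).log hr1).const_mul (-c)).congr_deriv (by ring)
  rw [integral_eq_sub_of_hasDerivAt hderiv]
  · simp
  · exact (continuousOn_div_one_sub continuousOn_const ht).intervalIntegrable_of_Icc ht₀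

lemma tendsto_integral_div_one_sub_atTop {α : ℝ → ℝ} (hα : ContinuousOn α (Icc 0 1))
    (hα1 : 0 < α 1) :
    Tendsto (fun t => ∫ r in (0:ℝ)..t, α r / (1 - r)) (𝓝[<] 1) atTop := by
  obtain ⟨c, hc, hcα⟩ := exists_between hα1
  obtain ⟨K, hK⟩ := exists_sub_le_div_one_sub hα hcα
  have hsub : Tendsto (fun t : ℝ => 1 - t) (𝓝[<] 1) (𝓝[>] 0) :=
    tendsto_nhdsWithin_iff.2
      ⟨((continuous_const.sub continuous_id).tendsto' (1:ℝ) 0 (by simp)).mono_left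
        nhdsWithin_le_nhds, eventually_mem_nhdsWithin.mono fun _ ht => mem_Ioi.2 (sub_pos.2 ht)⟩
  have hlog : Tendsto (fun t : ℝ => -c * Real.log (1 - t)) (𝓝[<] 1) atTop :=
    (Real.tendsto_log_nhdsGT_zero.comp hsub).const_mul_atBot_of_neg (neg_neg_of_pos hc)
  have hlin : Tendsto (fun t : ℝ => -(K * t)) (𝓝[<] 1) (𝓝 (-K)) :=
    ((continuous_const.mul continuous_id).neg.tendsto' (1:ℝ) (-K) (by simp)).mono_left
      nhdsWithin_le_nhds
  refine tendsto_atTop_mono' _ ?_ (hlog.atTop_add hlin)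
  filter_upwards [Ico_mem_nhdsLT (zero_lt_one (α := ℝ))] with t ht
  have hint : IntervalIntegrable (fun r => c / (1 - r)) volume 0 t :=
    (continuousOn_div_one_sub continuousOn_const ht.2).intervalIntegrable_of_Icc ht.1
  calc -c * Real.log (1 - t) + -(K * t) = ∫ r in (0:ℝ)..t, (c / (1 - r) - K) := by
        rw [integral_sub hint intervalIntegrable_const, integral_const_div_one_sub ht.1 ht.2,
          intervalIntegral.integral_const, smul_eq_mul]
        ring
    _ ≤ ∫ r in (0:ℝ)..t, α r / (1 - r) :=
        integral_mono_on ht.1 (hint.sub intervalIntegrable_const)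
          ((continuousOn_div_one_sub hα ht.2).intervalIntegrable_of_Icc ht.1)
          fun r hr => hK r ⟨hr.1, hr.2.trans_lt ht.2⟩

/-- Section 4.1 of the paper: for `α : [0,1] → ℝ` continuous with `α(1) > 0` and
`h(t) = α(t)/(1−t)`, condition (A1) holds (`h` is bounded from below and `∫₀ᵗ h → +∞`);
with `σ ≡ 1`, `Σ = 1` and `σ²/(Σ − ∫₀ᵗ σ²) = 1/(1−t)`, and `h` satisfies relation
(eq:hFbridge) if and only if `α ≡ 1` on `[0,1)`. -/
theorem alpha_pinned_brownian_diffusion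
    (α : ℝ → ℝ) (hα : ContinuousOn α (Set.Icc 0 1)) (hα1 : 0 < α 1) :
    -- (A1): `h(t) = α(t)/(1−t)` is bounded from below on `[0,1)` ...
    (∃ c : ℝ, ∀ t ∈ Set.Ico (0:ℝ) 1, c ≤ α t / (1 - t)) ∧
    -- ... and `∫₀ᵗ h → +∞` as `t → 1⁻`
    Tendsto (fun t => ∫ r in (0:ℝ)..t, α r / (1 - r)) (𝓝[<] 1) atTop ∧
    -- with `σ ≡ 1`: `Σ = lim_{t→1⁻} ∫₀ᵗ σ² = 1` (so (A2) holds)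
    Tendsto (fun t => ∫ r in (0:ℝ)..t, ((1:ℝ)) ^ 2) (𝓝[<] 1) (𝓝 1) ∧
    -- `σ(t)²/(Σ − ∫₀ᵗ σ²) = 1/(1−t)`
    (∀ t ∈ Set.Ico (0:ℝ) 1,
      ((1:ℝ)) ^ 2 / (1 - ∫ r in (0:ℝ)..t, ((1:ℝ)) ^ 2) = 1 / (1 - t)) ∧
    -- `h` satisfies (eq:hFbridge) iff `α ≡ 1` on `[0,1)`
    ((∀ t ∈ Set.Ico (0:ℝ) 1, α t / (1 - t) = 1 / (1 - t)) ↔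
      (∀ t ∈ Set.Ico (0:ℝ) 1, α t = 1)) := by
  refine ⟨?_, tendsto_integral_div_one_sub_atTop hα hα1, ?_, fun t _ => by simp,
    forall₂_congr fun t ht => div_left_inj' (sub_pos.2 ht.2).ne'⟩
  · obtain ⟨K, hK⟩ := exists_sub_le_div_one_sub hα hα1
    exact ⟨-K, fun t ht => by simpa using hK t ht⟩
  · have hid : Tendsto (fun t : ℝ => t) (𝓝[<] 1) (𝓝 1) := nhdsWithin_le_nhds
    simpa using hid
end
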